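/- arXiv:1007.2964 — 7 statements merged into one kernel-verified Lean document; each statement's English description precedes it below -/
import Mathlib

section
/- Let 𝒳 be a complete separable metric space, F a countable family of Borel measurable functions f : 𝒳 → [0,1], and X₁, X₂, … a stationary ergodic process with values in 𝒳 such that almost surely limsup_{m→∞} Γ_m(F) > η for some η > 0. Then 𝒳 is uncountable, and there exists a stationary ergodic process X̃₁, X̃₂, … with values in 𝒳 such that the marginal distribution of X̃₁ is non-atomic (P(X̃ᵢ = x) = 0 for every x ∈ 𝒳) and almost surely limsup_{m→∞} Γ_m(F) computed along X̃ exceeds η. -/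
open MeasureTheory Filter

universe u v

/-- The `m`-sample discrepancy of the family `F` at the sample point `ω`, for the
process `Xᵢ = ξ ∘ Tⁱ`. -/
noncomputable def discrepancy {Ω X : Type*} [MeasurableSpace Ω] (μ : Measure Ω)
    (T : Ω → Ω) (ξ : Ω → X) (F : Set (X → ℝ)) (m : ℕ) (ω : Ω) : ℝ :=
  ⨆ f : F, |(1 / (m : ℝ)) * ∑ i ∈ Finset.Icc 1 m, (f : X → ℝ) (ξ (T^[i] ω)) -
      ∫ x, (f : X → ℝ) (ξ x) ∂μ|

open Function Topology ProbabilityTheory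

section Birkhoff

variable {Ω : Type*}

/-- The running maximum of the Birkhoff sums `0, S₁, …, S_n` of `h` along `T`. -/
noncomputable def birkhoffMax (T : Ω → Ω) (h : Ω → ℝ) : ℕ → Ω → ℝ
  | 0 => fun _ => 0
  | n + 1 => fun ω => max 0 (h ω + birkhoffMax T h n (T ω))

theorem birkhoffMax_nonneg (T : Ω → Ω) (h : Ω → ℝ) (n : ℕ) (ω : Ω) :
    0 ≤ birkhoffMax T h n ω := by
  cases n with
  | zero => exact le_rfl
  | succ n => exact le_max_left _ _

theorem birkhoffMax_le_succ (T : Ω → Ω) (h : Ω → ℝ) (n : ℕ) (ω : Ω) :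
    birkhoffMax T h n ω ≤ birkhoffMax T h (n + 1) ω := by
  induction n generalizing ω with
  | zero => exact birkhoffMax_nonneg T h 1 ω
  | succ n ih => exact max_le_max le_rfl (add_le_add le_rfl (ih (T ω)))

theorem birkhoffSum_le_birkhoffMax (T : Ω → Ω) (h : Ω → ℝ) (n : ℕ) (ω : Ω) :
    birkhoffSum T h n ω ≤ birkhoffMax T h n ω := by
  induction n generalizing ω with
  | zero => simp [birkhoffMax]
  | succ n ih =>
    rw [birkhoffSum_succ']
    exact (add_le_add le_rfl (ih (T ω))).trans (le_max_right _ _)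

theorem bddAbove_birkhoffSum_comp_iff (T : Ω → Ω) (h : Ω → ℝ) (ω : Ω) :
    BddAbove (Set.range fun n => birkhoffSum T h n (T ω)) ↔
      BddAbove (Set.range fun n => birkhoffSum T h n ω) := by
  constructor
  · rintro ⟨C, hC⟩
    refine ⟨max 0 (h ω + C), ?_⟩
    rintro _ ⟨n, rfl⟩
    cases n with
    | zero => simp
    | succ n =>
      simp only [birkhoffSum_succ']
      exact (add_le_add le_rfl (hC ⟨n, rfl⟩)).trans (le_max_right _ _)
  · rintro ⟨C, hC⟩
    refine ⟨C - h ω, ?_⟩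
    rintro _ ⟨n, rfl⟩
    have := hC ⟨n + 1, rfl⟩
    simp only [birkhoffSum_succ'] at this
    exact le_sub_iff_add_le'.mpr this

variable [MeasurableSpace Ω] {μ : Measure Ω} {T : Ω → Ω}

theorem measurable_birkhoffMax (hT : Measurable T) {h : Ω → ℝ} (hh : Measurable h) (n : ℕ) :
    Measurable (birkhoffMax T h n) := by
  induction n with
  | zero => exact measurable_const
  | succ n ih => exact measurable_const.max (hh.add (ih.comp hT))

theorem integrable_birkhoffMax [IsFiniteMeasure μ] (hT : MeasurePreserving T μ μ) {h : Ω → ℝ}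
    (hi : Integrable h μ) (n : ℕ) : Integrable (birkhoffMax T h n) μ := by
  induction n with
  | zero => exact integrable_const _
  | succ n ih => exact (integrable_const 0).sup (hi.add (hT.integrable_comp_of_integrable ih))

theorem measurable_birkhoffSum (hT : Measurable T) {h : Ω → ℝ} (hh : Measurable h) (n : ℕ) :
    Measurable (birkhoffSum T h n) :=
  Finset.measurable_fun_sum _ fun i _ => hh.comp (hT.iterate i)

/-- If the Birkhoff sums of `h` are almost surely unbounded above, then `h` has nonnegative
integral. -/
theorem integral_nonneg_of_ae_not_bddAbove_birkhoffSum [IsFiniteMeasure μ]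
    (hT : MeasurePreserving T μ μ) {h : Ω → ℝ} (hh : Measurable h) (hi : Integrable h μ)
    (hE : ∀ᵐ ω ∂μ, ¬ BddAbove (Set.range fun n => birkhoffSum T h n ω)) : 0 ≤ ∫ ω, h ω ∂μ := by
  have hI := integrable_birkhoffMax hT hi
  have hlim : Tendsto (fun n => ∫ ω, max (-birkhoffMax T h n (T ω)) (h ω) ∂μ) atTop
      (𝓝 (∫ ω, h ω ∂μ)) := by
    refine tendsto_integral_of_dominated_convergence (fun ω => |h ω|) (fun n => ?_) hi.abs
      (fun n => ?_) ?_
    · exact (((measurable_birkhoffMax hT.measurable hh n).comp hT.measurable).neg.max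
        hh).aestronglyMeasurable
    · filter_upwards with ω
      have := birkhoffMax_nonneg T h n (T ω)
      rw [Real.norm_eq_abs]
      rcases max_cases (-birkhoffMax T h n (T ω)) (h ω) with ⟨e, h'⟩ | ⟨e, h'⟩ <;> rw [e]
      rw [abs_of_nonpos (by linarith), abs_of_nonpos (by linarith)]
      linarith
    · filter_upwards [hE] with ω hω
      rw [← bddAbove_birkhoffSum_comp_iff] at hω
      have hM : ∃ n, -h ω < birkhoffMax T h n (T ω) := by
        by_contra! hc
        refine hω ⟨-h ω, ?_⟩
        rintro _ ⟨n, rfl⟩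
        exact (birkhoffSum_le_birkhoffMax T h n _).trans (hc n)
      obtain ⟨n, hn⟩ := hM
      refine tendsto_const_nhds.congr' ?_
      filter_upwards [eventually_ge_atTop n] with k hk
      have := monotone_nat_of_le_succ (fun j => birkhoffMax_le_succ T h j (T ω)) hk
      exact (max_eq_right (by linarith)).symm
  refine ge_of_tendsto' hlim fun n => ?_
  have key : ∀ ω, max (-birkhoffMax T h n (T ω)) (h ω) =
      birkhoffMax T h (n + 1) ω - birkhoffMax T h n (T ω) := by
    intro ω
    rw [birkhoffMax, ← max_sub_sub_right]
    simp
  have hc : Integrable (fun ω => birkhoffMax T h n (T ω)) μ :=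
    hT.integrable_comp_of_integrable (hI n)
  have hmap : ∫ ω, birkhoffMax T h n (T ω) ∂μ = ∫ ω, birkhoffMax T h n ω ∂μ := by
    conv_rhs => rw [← hT.map_eq]
    exact (integral_map hT.aemeasurable
      (measurable_birkhoffMax hT.measurable hh n).aestronglyMeasurable).symm
  simp only [key]
  rw [integral_sub (hI _) hc, hmap]
  exact sub_nonneg.mpr (integral_mono (hI _) (hI _) (birkhoffMax_le_succ T h n))

theorem Ergodic.ae_bddAbove_birkhoffSum [IsFiniteMeasure μ] (hT : Ergodic T μ) {h : Ω → ℝ}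
    (hh : Measurable h) (hi : Integrable h μ) (hneg : ∫ ω, h ω ∂μ < 0) :
    ∀ᵐ ω ∂μ, BddAbove (Set.range fun n => birkhoffSum T h n ω) := by
  have hm : MeasurableSet {ω | BddAbove (Set.range fun n => birkhoffSum T h n ω)} :=
    measurableSet_bddAbove_range (measurable_birkhoffSum hT.measurable hh)
  refine (hT.toPreErgodic.ae_mem_or_ae_notMem hm ?_).resolve_right fun hE => ?_
  · ext ω
    exact bddAbove_birkhoffSum_comp_iff T h ω
  · exact hneg.not_ge
      (integral_nonneg_of_ae_not_bddAbove_birkhoffSum hT.toMeasurePreserving hh hi hE)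

theorem Ergodic.ae_eventually_birkhoffAverage_lt [IsProbabilityMeasure μ] (hT : Ergodic T μ)
    {g : Ω → ℝ} (hg : Measurable g) (hi : Integrable g μ) {c : ℝ} (hc : ∫ ω, g ω ∂μ < c) :
    ∀ᵐ ω ∂μ, ∀ᶠ n in atTop, birkhoffAverage ℝ T g n ω < c := by
  obtain ⟨d, hgd, hdc⟩ := exists_between hc
  have := hT.ae_bddAbove_birkhoffSum (hg.sub_const d) (hi.sub (integrable_const d)) (by
    rw [integral_sub hi (integrable_const d)]
    simpa using hgd)
  filter_upwards [this] with ω ⟨C, hC⟩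
  have hlim : Tendsto (fun n : ℕ => d + C / n) atTop (𝓝 (d + 0)) :=
    tendsto_const_nhds.add (tendsto_const_div_atTop_nhds_zero_nat C)
  filter_upwards [hlim.eventually_lt_const (by simpa using hdc), eventually_gt_atTop 0]
    with n hn hn0
  refine lt_of_le_of_lt ?_ hn
  have h1 := hC ⟨n, rfl⟩
  have hn0' : (0 : ℝ) < n := by exact_mod_cast hn0
  simp only [birkhoffSum, Finset.sum_sub_distrib, Finset.sum_const, Finset.card_range,
    nsmul_eq_mul] at h1
  rw [birkhoffAverage, birkhoffSum, smul_eq_mul, inv_mul_le_iff₀ hn0']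
  field_simp
  linarith

/-- Birkhoff's pointwise ergodic theorem for ergodic maps. -/
theorem Ergodic.ae_tendsto_birkhoffAverage [IsProbabilityMeasure μ] (hT : Ergodic T μ)
    {g : Ω → ℝ} (hg : Measurable g) (hi : Integrable g μ) :
    ∀ᵐ ω ∂μ, Tendsto (fun n => birkhoffAverage ℝ T g n ω) atTop (𝓝 (∫ ω, g ω ∂μ)) := by
  have hup : ∀ᵐ ω ∂μ, ∀ k : ℕ, ∀ᶠ n in atTop,
      birkhoffAverage ℝ T g n ω < (∫ ω, g ω ∂μ) + 1 / ((k : ℝ) + 1) :=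
    ae_all_iff.mpr fun k => hT.ae_eventually_birkhoffAverage_lt hg hi
      (lt_add_of_pos_right _ Nat.one_div_pos_of_nat)
  have hlo : ∀ᵐ ω ∂μ, ∀ k : ℕ, ∀ᶠ n in atTop,
      birkhoffAverage ℝ T (-g) n ω < (∫ ω, (-g) ω ∂μ) + 1 / ((k : ℝ) + 1) :=
    ae_all_iff.mpr fun k => hT.ae_eventually_birkhoffAverage_lt hg.neg hi.neg
      (lt_add_of_pos_right _ Nat.one_div_pos_of_nat)
  filter_upwards [hup, hlo] with ω h1 h2
  rw [Metric.tendsto_nhds]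
  intro ε hε
  obtain ⟨k, hk⟩ := exists_nat_one_div_lt hε
  filter_upwards [h1 k, h2 k] with n h1 h2
  rw [birkhoffAverage_neg] at h2
  simp only [Pi.neg_apply, integral_neg] at h2
  rw [Real.dist_eq, abs_lt]
  constructor <;> linarith

end Birkhoff

section FirstReturn

variable {Ω : Type*} {T G : Ω → Ω} {B : Set Ω}

/-- `G` sends `ω` to the first of the points `T ω, T² ω, …` which lies in `B`, if there is one. -/
structure IsFirstReturn (T : Ω → Ω) (B : Set Ω) (G : Ω → Ω) : Prop where
  eq_of_mem : ∀ ω, T ω ∈ B → G ω = T ω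
  eq_of_notMem : ∀ ω, T ω ∉ B → G ω = G (T ω)

theorem exists_measurable_isFirstReturn [Nonempty Ω] [MeasurableSpace Ω] (hT : Measurable T)
    (hB : MeasurableSet B) : ∃ G, Measurable G ∧ IsFirstReturn T B G := by
  classical
  obtain ⟨ω₀⟩ := ‹Nonempty Ω›
  let never : Set Ω := {ω | ∀ k, T^[k + 1] ω ∉ B}
  let p : ℕ → Ω → Prop := fun n ω => T^[n + 1] ω ∈ B ∨ ω ∈ never
  have hnever : MeasurableSet never := by
    have : never = ⋂ k, (T^[k + 1])⁻¹' Bᶜ := by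
      ext; simp [never]
    rw [this]
    exact .iInter fun k => hT.iterate _ hB.compl
  have hp : ∀ ω, ∃ n, p n ω := by
    intro ω
    by_cases h : ω ∈ never
    · exact ⟨0, .inr h⟩
    · simp only [never, Set.mem_ofPred_eq, not_forall, not_not] at h
      exact h.imp fun k hk => .inl hk
  have hfind : Measurable fun ω => T^[Nat.find (hp ω) + 1] ω :=
    Measurable.find (f := fun n => T^[n + 1]) (p := p) (fun n => hT.iterate _)
      (fun n => (hT.iterate (n + 1) hB).union hnever) hp
  refine ⟨never.piecewise (fun _ => ω₀) fun ω => T^[Nat.find (hp ω) + 1] ω,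
    measurable_const.piecewise hnever hfind, ⟨fun ω hω => ?_, fun ω hω => ?_⟩⟩
  · have hn : ω ∉ never := fun h => h 0 hω
    have : Nat.find (hp ω) = 0 := (Nat.find_eq_zero _).mpr (.inl hω)
    simp [hn, this]
  · have hiff : T ω ∈ never ↔ ω ∈ never := by
      constructor
      · intro h k
        cases k with
        | zero => exact hω
        | succ k => exact h k
      · exact fun h k => h (k + 1)
    by_cases hn : ω ∈ never
    · simp [hn, hiff.mpr hn]
    · have hn' := mt hiff.mp hn
      have : Nat.find (hp ω) = Nat.find (hp (T ω)) + 1 := by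
        rw [Nat.find_eq_iff]
        refine ⟨.inl ((Nat.find_spec (hp (T ω))).resolve_right hn'), fun n hlt hpn => ?_⟩
        have hpn := hpn.resolve_right hn
        cases n with
        | zero => exact hω hpn
        | succ n => exact Nat.find_min (hp (T ω)) (Nat.lt_of_succ_lt_succ hlt) (.inl hpn)
      simp only [Set.piecewise_eq_of_notMem _ _ _ hn, Set.piecewise_eq_of_notMem _ _ _ hn', this]
      rfl

namespace IsFirstReturn

theorem preimage_eq_of_preimage_eq (hG : IsFirstReturn T B G) {E : Set Ω} (hE : G ⁻¹' E = E) :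
    T ⁻¹' E = E := by
  have hmem : ∀ ω, G ω ∈ E ↔ ω ∈ E := fun ω => Set.ext_iff.mp hE ω
  ext ω
  rw [Set.mem_preimage, ← hmem ω]
  by_cases h : T ω ∈ B
  · rw [hG.eq_of_mem ω h]
  · rw [hG.eq_of_notMem ω h, hmem]

theorem exists_birkhoffSum_eq (hG : IsFirstReturn T B G) (m : ℕ) (ω : Ω) :
    ∃ N : ℕ, birkhoffSum T (B.indicator fun _ => (1 : ℝ)) m (T ω) = N ∧
      ∀ φ : Ω → ℝ, birkhoffSum T (B.indicator φ) m (T ω) = birkhoffSum G φ N (G ω) := by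
  induction m generalizing ω with
  | zero => exact ⟨0, by simp, by simp⟩
  | succ m ih =>
    obtain ⟨N, hN, hφ⟩ := ih (T ω)
    by_cases h : T ω ∈ B
    · refine ⟨N + 1, ?_, fun φ => ?_⟩
      · rw [birkhoffSum_succ', hN, Set.indicator_of_mem h]
        push_cast
        ring
      · rw [birkhoffSum_succ', hφ, Set.indicator_of_mem h, birkhoffSum_succ', hG.eq_of_mem ω h]
    · refine ⟨N, ?_, fun φ => ?_⟩
      · rw [birkhoffSum_succ', hN, Set.indicator_of_notMem h, zero_add]
      · rw [birkhoffSum_succ', hφ, Set.indicator_of_notMem h, zero_add, hG.eq_of_notMem ω h]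

variable [MeasurableSpace Ω] {μ : Measure Ω}

theorem measure_inter_preimage [IsFiniteMeasure μ] (hG : IsFirstReturn T B G)
    (hT : MeasurePreserving T μ μ) (hGm : Measurable G) (hB : MeasurableSet B) {E : Set Ω}
    (hE : MeasurableSet E) : μ (B ∩ G ⁻¹' E) = μ (B ∩ E) := by
  have hGE := hGm hE
  have hsplit : G ⁻¹' E = T ⁻¹' (B ∩ E) ∪ T ⁻¹' (G ⁻¹' E \ B) := by
    ext ω
    by_cases h : T ω ∈ B
    · simp [h, hG.eq_of_mem ω h]
    · simp [h, hG.eq_of_notMem ω h]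
  have hdisj : Disjoint (T ⁻¹' (B ∩ E)) (T ⁻¹' (G ⁻¹' E \ B)) :=
    (Set.disjoint_sdiff_right.mono_left Set.inter_subset_left).preimage T
  have h1 : μ (G ⁻¹' E) = μ (B ∩ E) + μ (G ⁻¹' E \ B) := by
    conv_lhs => rw [hsplit]
    rw [measure_union hdisj (hT.measurable (hGE.diff hB)),
      hT.measure_preimage (hB.inter hE).nullMeasurableSet,
      hT.measure_preimage (hGE.diff hB).nullMeasurableSet]
  have h2 : μ (G ⁻¹' E) = μ (B ∩ G ⁻¹' E) + μ (G ⁻¹' E \ B) := by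
    rw [Set.inter_comm, measure_inter_add_sdiff _ hB]
  exact (ENNReal.add_left_inj (measure_ne_top μ _)).mp (h2.symm.trans h1)

theorem ergodic_cond [IsFiniteMeasure μ] (hG : IsFirstReturn T B G) (hT : Ergodic T μ)
    (hGm : Measurable G) (hB : MeasurableSet B) : Ergodic G μ[|B] where
  measurable := hGm
  map_eq := by
    ext E hE
    rw [Measure.map_apply hGm hE, cond_apply hB, cond_apply hB,
      hG.measure_inter_preimage hT.toMeasurePreserving hGm hB hE]
  aeconst_set _ hE hGE :=
    (hT.aeconst_set hE (hG.preimage_eq_of_preimage_eq hGE)).anti cond_absolutelyContinuous.ae_le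

end IsFirstReturn

end FirstReturn

section BirkhoffAverage

variable {Ω : Type*} (T : Ω → Ω)

theorem birkhoffAverage_mono {φ ψ : Ω → ℝ} (h : φ ≤ ψ) (m : ℕ) (ω : Ω) :
    birkhoffAverage ℝ T φ m ω ≤ birkhoffAverage ℝ T ψ m ω := by
  rw [birkhoffAverage, birkhoffAverage, smul_eq_mul, smul_eq_mul]
  exact mul_le_mul_of_nonneg_left (Finset.sum_le_sum fun i _ => h _) (by positivity)

theorem birkhoffAverage_nonneg {φ : Ω → ℝ} (h : 0 ≤ φ) (m : ℕ) (ω : Ω) :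
    0 ≤ birkhoffAverage ℝ T φ m ω := by
  simpa [birkhoffAverage, birkhoffSum] using birkhoffAverage_mono T h m ω

theorem birkhoffAverage_le_one {φ : Ω → ℝ} (h : φ ≤ 1) (m : ℕ) (ω : Ω) :
    birkhoffAverage ℝ T φ m ω ≤ 1 := by
  refine (birkhoffAverage_mono T h m ω).trans ?_
  simpa [birkhoffAverage, birkhoffSum] using inv_mul_le_one (a := (m : ℝ))

theorem birkhoffAverage_sum_mul {ι : Type*} (K : Finset ι) (c : ι → ℝ) (φ : ι → Ω → ℝ)
    (m : ℕ) (ω : Ω) :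
    birkhoffAverage ℝ T (fun x => ∑ a ∈ K, c a * φ a x) m ω =
      ∑ a ∈ K, c a * birkhoffAverage ℝ T (φ a) m ω := by
  simp only [birkhoffAverage, birkhoffSum, smul_eq_mul]
  rw [Finset.sum_comm, Finset.mul_sum]
  refine Finset.sum_congr rfl fun a _ => ?_
  rw [← Finset.mul_sum]
  ring

theorem natCast_mul_birkhoffAverage (φ : Ω → ℝ) (m : ℕ) (ω : Ω) :
    (m : ℝ) * birkhoffAverage ℝ T φ m ω = birkhoffSum T φ m ω := by
  rcases eq_or_ne m 0 with rfl | hm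
  · simp
  · rw [birkhoffAverage, smul_eq_mul, mul_inv_cancel_left₀ (by exact_mod_cast hm)]

theorem sum_Icc_iterate (φ : Ω → ℝ) (m : ℕ) (ω : Ω) :
    ∑ i ∈ Finset.Icc 1 m, φ (T^[i] ω) = birkhoffSum T φ m (T ω) := by
  induction m with
  | zero => simp
  | succ m ih =>
    rw [Finset.sum_Icc_succ_top (by omega), ih, birkhoffSum_succ, Function.iterate_succ_apply]

end BirkhoffAverage

section Discrepancy

variable {Ω X : Type*} [MeasurableSpace Ω] {μ : Measure Ω} {T : Ω → Ω} {ξ : Ω → X}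
  {F : Set (X → ℝ)}

theorem discrepancy_eq (μ : Measure Ω) (T : Ω → Ω) (ξ : Ω → X) (F : Set (X → ℝ)) (m : ℕ)
    (ω : Ω) : discrepancy μ T ξ F m ω =
      ⨆ f : F, |birkhoffAverage ℝ T ((f : X → ℝ) ∘ ξ) m (T ω) - ∫ x, (f : X → ℝ) (ξ x) ∂μ| := by
  simp only [discrepancy, birkhoffAverage, smul_eq_mul, one_div, ← sum_Icc_iterate, comp_apply]

theorem discrepancy_nonneg (μ : Measure Ω) (T : Ω → Ω) (ξ : Ω → X) (F : Set (X → ℝ)) (m : ℕ)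
    (ω : Ω) : 0 ≤ discrepancy μ T ξ F m ω :=
  Real.iSup_nonneg fun _ => abs_nonneg _

theorem discrepancy_le {c : ℝ} {m : ℕ} {ω : Ω} (hc : 0 ≤ c)
    (h : ∀ f ∈ F, |birkhoffAverage ℝ T (f ∘ ξ) m (T ω) - ∫ x, f (ξ x) ∂μ| ≤ c) :
    discrepancy μ T ξ F m ω ≤ c := by
  rw [discrepancy_eq]
  exact Real.iSup_le (fun f => h f f.2) hc

theorem abs_birkhoffAverage_sub_integral_le_one [IsProbabilityMeasure μ] {f : X → ℝ}
    (hf : ∀ x, f x ∈ Set.Icc (0 : ℝ) 1) (m : ℕ) (ω : Ω) :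
    |birkhoffAverage ℝ T (f ∘ ξ) m ω - ∫ x, f (ξ x) ∂μ| ≤ 1 := by
  have h1 : 0 ≤ birkhoffAverage ℝ T (f ∘ ξ) m ω :=
    birkhoffAverage_nonneg T (fun x => (hf (ξ x)).1) m ω
  have h2 : birkhoffAverage ℝ T (f ∘ ξ) m ω ≤ 1 :=
    birkhoffAverage_le_one T (fun x => (hf (ξ x)).2) m ω
  have h3 : 0 ≤ ∫ x, f (ξ x) ∂μ := integral_nonneg fun x => (hf (ξ x)).1
  have h4 : ∫ x, f (ξ x) ∂μ ≤ 1 := by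
    have := integral_mono_of_nonneg (μ := μ) (ae_of_all _ fun x => (hf (ξ x)).1)
      (integrable_const (1 : ℝ)) (ae_of_all _ fun x => (hf (ξ x)).2)
    simpa using this
  rw [abs_le]
  constructor <;> linarith

theorem discrepancy_le_one [IsProbabilityMeasure μ]
    (hFb : ∀ f ∈ F, ∀ x, f x ∈ Set.Icc (0 : ℝ) 1) (m : ℕ) (ω : Ω) :
    discrepancy μ T ξ F m ω ≤ 1 :=
  discrepancy_le zero_le_one fun f hf => abs_birkhoffAverage_sub_integral_le_one (hFb f hf) m _

theorem le_discrepancy [IsProbabilityMeasure μ]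
    (hFb : ∀ f ∈ F, ∀ x, f x ∈ Set.Icc (0 : ℝ) 1) {f : X → ℝ} (hf : f ∈ F) (m : ℕ) (ω : Ω) :
    |birkhoffAverage ℝ T (f ∘ ξ) m (T ω) - ∫ x, f (ξ x) ∂μ| ≤ discrepancy μ T ξ F m ω := by
  rw [discrepancy_eq]
  refine le_ciSup (f := fun f : F =>
    |birkhoffAverage ℝ T ((f : X → ℝ) ∘ ξ) m (T ω) - ∫ x, (f : X → ℝ) (ξ x) ∂μ|) ⟨1, ?_⟩ ⟨f, hf⟩
  rintro _ ⟨g, rfl⟩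
  exact abs_birkhoffAverage_sub_integral_le_one (hFb g g.2) m _

theorem frequently_lt_discrepancy {η : ℝ} {ω : Ω}
    (h : η < limsup (fun m : ℕ => discrepancy μ T ξ F m ω) atTop) :
    ∃ᶠ m in atTop, η < discrepancy μ T ξ F m ω :=
  have hbdd : IsBoundedUnder (· ≥ ·) atTop fun m => discrepancy μ T ξ F m ω :=
    isBoundedUnder_of ⟨0, fun m => discrepancy_nonneg μ T ξ F m ω⟩
  frequently_lt_of_lt_limsup hbdd.isCoboundedUnder_le h

theorem le_limsup_discrepancy [IsProbabilityMeasure μ]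
    (hFb : ∀ f ∈ F, ∀ x, f x ∈ Set.Icc (0 : ℝ) 1) {η : ℝ} {ω : Ω}
    (h : ∃ᶠ m in atTop, η ≤ discrepancy μ T ξ F m ω) :
    η ≤ limsup (fun m : ℕ => discrepancy μ T ξ F m ω) atTop :=
  le_limsup_of_frequently_le h (isBoundedUnder_of ⟨1, fun m => discrepancy_le_one hFb m ω⟩)

theorem measurable_discrepancy [MeasurableSpace X] (hT : Measurable T) (hξ : Measurable ξ)
    (hFc : F.Countable) (hFm : ∀ f ∈ F, Measurable f) (m : ℕ) :
    Measurable (discrepancy μ T ξ F m) := by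
  have := hFc.to_subtype
  refine Measurable.iSup fun f => ?_
  have hs : Measurable fun ω => ∑ i ∈ Finset.Icc 1 m, (f : X → ℝ) (ξ (T^[i] ω)) :=
    Finset.measurable_fun_sum _ fun i _ => (hFm f f.2).comp (hξ.comp (hT.iterate i))
  exact ((hs.const_mul _).sub_const _).abs

/-- Every process is isomorphic, as far as discrepancies are concerned, to one carried by the
shift on the sequence space. -/
theorem exists_sequence_process_with_large_discrepancy [MeasurableSpace X]
    [IsProbabilityMeasure μ] (hT : Ergodic T μ) (hξ : Measurable ξ) (hFc : F.Countable)
    (hFm : ∀ f ∈ F, Measurable f) {η : ℝ}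
    (h : ∀ᵐ ω ∂μ, η < limsup (fun m : ℕ => discrepancy μ T ξ F m ω) atTop) :
    ∃ (ν : Measure (ℕ → X)) (S : (ℕ → X) → ℕ → X) (ζ : (ℕ → X) → X),
      IsProbabilityMeasure ν ∧ Ergodic S ν ∧ Measurable ζ ∧ ν.map ζ = μ.map ξ ∧
      ∀ᵐ x ∂ν, η < limsup (fun m : ℕ => discrepancy ν S ζ F m x) atTop := by
  let π : Ω → ℕ → X := fun ω n => ξ (T^[n] ω)
  let S : (ℕ → X) → ℕ → X := fun x n => x (n + 1)
  let ζ : (ℕ → X) → X := fun x => x 0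
  have hπ : Measurable π := measurable_pi_lambda _ fun n => hξ.comp (hT.measurable.iterate n)
  have hS : Measurable S := measurable_pi_lambda _ fun n => measurable_pi_apply (n + 1)
  have hζ : Measurable ζ := measurable_pi_apply 0
  have hmp : MeasurePreserving π μ (μ.map π) := hπ.measurePreserving μ
  have hsemi : Semiconj π T S := fun ω => rfl
  have hdisc : ∀ m ω, discrepancy (μ.map π) S ζ F m (π ω) = discrepancy μ T ξ F m ω := by
    intro m ω
    simp only [discrepancy]
    congr! 6 with f
    · exact congrArg (f : X → ℝ) (congrFun ((hsemi.iterate_right _).eq ω).symm 0)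
    · exact integral_map hπ.aemeasurable ((hFm f f.2).comp hζ).aestronglyMeasurable
  refine ⟨μ.map π, S, ζ, Measure.isProbabilityMeasure_map hπ.aemeasurable,
    hmp.ergodic_of_ergodic_semiconj hT hS hsemi, hζ, ?_, ?_⟩
  · rw [Measure.map_map hζ hπ]
    rfl
  · rw [ae_map_iff hπ.aemeasurable]
    · simpa only [hdisc] using h
    · exact measurableSet_lt measurable_const
        (Measurable.limsup fun m => measurable_discrepancy hS hζ hFc hFm m)

variable [MeasurableSpace X]

theorem integrable_comp_of_mem_Icc [IsFiniteMeasure μ] (hξ : Measurable ξ) {f : X → ℝ}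
    (hf : Measurable f) (hfb : ∀ x, f x ∈ Set.Icc (0 : ℝ) 1) : Integrable (fun ω => f (ξ ω)) μ :=
  Integrable.of_bound (hf.comp hξ).aestronglyMeasurable 1 <| ae_of_all _ fun ω => by
    rw [Real.norm_eq_abs, abs_of_nonneg (hfb _).1]
    exact (hfb _).2

theorem ae_tendsto_birkhoffAverage_indicator [IsProbabilityMeasure μ] (hT : Ergodic T μ)
    {B : Set Ω} (hB : MeasurableSet B) :
    ∀ᵐ ω ∂μ, Tendsto (fun m => birkhoffAverage ℝ T (B.indicator fun _ => (1 : ℝ)) m (T ω)) atTop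
      (𝓝 (μ.real B)) := by
  have := hT.ae_tendsto_birkhoffAverage (measurable_const.indicator hB)
    ((integrable_const (1 : ℝ)).indicator hB)
  rw [integral_indicator_const _ hB, smul_eq_mul, mul_one] at this
  exact hT.quasiMeasurePreserving.ae this

/-- Over a countable set, Birkhoff averages converge uniformly in the integrand. -/
theorem ae_eventually_abs_birkhoffAverage_indicator_sub_integral_le [MeasurableSingletonClass X]
    [IsProbabilityMeasure μ] (hT : Ergodic T μ) (hξ : Measurable ξ) {A : Set X}
    (hA : A.Countable) :
    ∀ᵐ ω ∂μ, ∀ ε > 0, ∀ᶠ m in atTop, ∀ f : X → ℝ, Measurable f →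
      (∀ x, f x ∈ Set.Icc (0 : ℝ) 1) →
      |birkhoffAverage ℝ T ((ξ ⁻¹' A).indicator (f ∘ ξ)) m (T ω) -
        ∫ x, (ξ ⁻¹' A).indicator (f ∘ ξ) x ∂μ| ≤ ε := by
  have := hA.to_subtype
  have hKm : ∀ K : Finset A, MeasurableSet (ξ ⁻¹' (A \ (↑) '' (K : Set A))) := fun K =>
    hξ (hA.measurableSet.diff (K.finite_toSet.image _).measurableSet)
  have hsing : ∀ᵐ ω ∂μ, ∀ a : A, Tendsto (fun m => birkhoffAverage ℝ T
      ((ξ ⁻¹' {(a : X)}).indicator fun _ => (1 : ℝ)) m (T ω)) atTop (𝓝 (μ.real (ξ ⁻¹' {(a : X)}))) :=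
    ae_all_iff.mpr fun a => ae_tendsto_birkhoffAverage_indicator hT (hξ (measurableSet_singleton _))
  have htail : ∀ᵐ ω ∂μ, ∀ K : Finset A, Tendsto (fun m => birkhoffAverage ℝ T
      ((ξ ⁻¹' (A \ (↑) '' (K : Set A))).indicator fun _ => (1 : ℝ)) m (T ω)) atTop
      (𝓝 (μ.real (ξ ⁻¹' (A \ (↑) '' (K : Set A))))) :=
    ae_all_iff.mpr fun K => ae_tendsto_birkhoffAverage_indicator hT (hKm K)
  have hsmall : Tendsto (fun K : Finset A => μ.real (ξ ⁻¹' (A \ (↑) '' (K : Set A)))) atTop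
      (𝓝 0) := by
    have hanti : Antitone fun K : Finset A => ξ ⁻¹' (A \ (↑) '' (K : Set A)) := fun K L hKL =>
      Set.preimage_mono (Set.sdiff_subset_sdiff_right (Set.image_mono (by exact_mod_cast hKL)))
    have hinter : ⋂ K : Finset A, ξ ⁻¹' (A \ (↑) '' (K : Set A)) = ∅ := by
      refine Set.eq_empty_of_forall_notMem fun ω hω => ?_
      rw [Set.mem_iInter] at hω
      have hA' : ξ ω ∈ A := (hω ∅).1
      exact (hω {⟨ξ ω, hA'⟩}).2 ⟨⟨ξ ω, hA'⟩, by simp, rfl⟩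
    have := tendsto_measure_iInter_atTop (μ := μ) (fun K => (hKm K).nullMeasurableSet) hanti
      ⟨∅, measure_ne_top μ _⟩
    rw [hinter, measure_empty] at this
    exact (ENNReal.tendsto_toReal ENNReal.zero_ne_top).comp this
  filter_upwards [hsing, htail] with ω hsing htail ε hε
  obtain ⟨K, hK⟩ := (hsmall.eventually_lt_const (half_pos hε)).exists
  set R : Set Ω := ξ ⁻¹' (A \ (↑) '' (K : Set A)) with hR
  have hsum : Tendsto (fun m => ∑ a ∈ K, |birkhoffAverage ℝ T
      ((ξ ⁻¹' {(a : X)}).indicator fun _ => (1 : ℝ)) m (T ω) - μ.real (ξ ⁻¹' {(a : X)})|) atTop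
      (𝓝 0) := by
    have := tendsto_finsetSum K fun a _ => ((hsing a).sub_const (μ.real (ξ ⁻¹' {(a : X)}))).abs
    simpa using this
  filter_upwards [hsum.eventually_lt_const (half_pos hε), (htail K).eventually_lt_const hK]
    with m hm1 hm2 f hf hfb
  have hdecomp : (ξ ⁻¹' A).indicator (f ∘ ξ) =
      (fun x => ∑ a ∈ K, f a * (ξ ⁻¹' {(a : X)}).indicator (fun _ => (1 : ℝ)) x) +
        R.indicator (f ∘ ξ) := by
    classical
    ext x
    simp only [Pi.add_apply, Set.indicator_apply, Set.mem_preimage, Set.mem_singleton_iff,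
      mul_ite, mul_one, mul_zero, comp_apply, hR]
    by_cases hx : ξ x ∈ A
    · have hiff : ∀ a : A, ξ x = a ↔ (⟨ξ x, hx⟩ : A) = a := fun a => by rw [Subtype.ext_iff]
      simp only [hiff, Finset.sum_ite_eq]
      by_cases hxK : (⟨ξ x, hx⟩ : A) ∈ K <;> simp [hx, hxK]
    · have hne : ∀ a : A, ξ x ≠ a := fun a h => hx (h ▸ a.2)
      simp [hx, hne]
  have hRm : MeasurableSet R := hKm K
  have hIR : Integrable (R.indicator (f ∘ ξ)) μ :=
    (integrable_comp_of_mem_Icc hξ hf hfb).indicator hRm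
  have hIs : ∀ a : A, Integrable
      (fun x => f a * (ξ ⁻¹' {(a : X)}).indicator (fun _ => (1 : ℝ)) x) μ := fun a =>
    ((integrable_const (1 : ℝ)).indicator (hξ (measurableSet_singleton _))).const_mul _
  have hint : ∫ x, (ξ ⁻¹' A).indicator (f ∘ ξ) x ∂μ =
      ∑ a ∈ K, f a * μ.real (ξ ⁻¹' {(a : X)}) + ∫ x, R.indicator (f ∘ ξ) x ∂μ := by
    rw [hdecomp]
    simp only [Pi.add_apply]
    rw [integral_add (integrable_finsetSum _ fun a _ => hIs a) hIR,
      integral_finsetSum _ fun a _ => hIs a]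
    congr 1
    refine Finset.sum_congr rfl fun a _ => ?_
    rw [integral_const_mul, integral_indicator_const _ (hξ (measurableSet_singleton _)),
      smul_eq_mul, mul_one]
  have hRle : R.indicator (f ∘ ξ) ≤ R.indicator fun _ => (1 : ℝ) :=
    fun x => Set.indicator_le_indicator (hfb (ξ x)).2
  have hRnn : 0 ≤ R.indicator (f ∘ ξ) := Set.indicator_nonneg fun x _ => (hfb _).1
  have h1 := birkhoffAverage_nonneg T hRnn m (T ω)
  have h2 := birkhoffAverage_mono T hRle m (T ω)
  have h3 : 0 ≤ ∫ x, R.indicator (f ∘ ξ) x ∂μ := integral_nonneg hRnn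
  have h4 : ∫ x, R.indicator (f ∘ ξ) x ∂μ ≤ μ.real R := by
    have := integral_mono hIR ((integrable_const (1 : ℝ)).indicator hRm) hRle
    rwa [integral_indicator_const _ hRm, smul_eq_mul, mul_one] at this
  have h5 : |∑ a ∈ K, f a * birkhoffAverage ℝ T
      ((ξ ⁻¹' {(a : X)}).indicator fun _ => (1 : ℝ)) m (T ω) -
        ∑ a ∈ K, f a * μ.real (ξ ⁻¹' {(a : X)})| < ε / 2 := by
    rw [← Finset.sum_sub_distrib]
    refine ((Finset.abs_sum_le_sum_abs _ _).trans (Finset.sum_le_sum fun a _ => ?_)).trans_lt hm1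
    rw [← mul_sub, abs_mul, abs_of_nonneg (hfb a).1]
    exact mul_le_of_le_one_left (abs_nonneg _) (hfb a).2
  rw [hint, hdecomp, birkhoffAverage_add, Pi.add_apply, Pi.add_apply, birkhoffAverage_sum_mul]
  rw [abs_lt] at h5
  rw [abs_le]
  constructor <;> linarith

theorem ae_eventually_abs_birkhoffAverage_sub_integral_le_add [MeasurableSingletonClass X]
    [IsProbabilityMeasure μ] (hT : Ergodic T μ) (hξ : Measurable ξ) {A : Set X}
    (hA : A.Countable) :
    ∀ᵐ ω ∂μ, ∀ ε > 0, ∀ᶠ m in atTop, ∀ f : X → ℝ, Measurable f →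
      (∀ x, f x ∈ Set.Icc (0 : ℝ) 1) →
      |birkhoffAverage ℝ T (f ∘ ξ) m (T ω) - ∫ x, f (ξ x) ∂μ| ≤
        |birkhoffAverage ℝ T ((ξ ⁻¹' A)ᶜ.indicator (f ∘ ξ)) m (T ω) -
          ∫ x, (ξ ⁻¹' A)ᶜ.indicator (f ∘ ξ) x ∂μ| + ε := by
  have hAm : MeasurableSet (ξ ⁻¹' A) := hξ hA.measurableSet
  filter_upwards [ae_eventually_abs_birkhoffAverage_indicator_sub_integral_le hT hξ hA]
    with ω hω ε hε
  filter_upwards [hω ε hε] with m hm f hf hfb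
  have hi : Integrable (f ∘ ξ) μ := integrable_comp_of_mem_Icc hξ hf hfb
  have h1 : birkhoffAverage ℝ T (f ∘ ξ) m (T ω) =
      birkhoffAverage ℝ T ((ξ ⁻¹' A).indicator (f ∘ ξ)) m (T ω) +
        birkhoffAverage ℝ T ((ξ ⁻¹' A)ᶜ.indicator (f ∘ ξ)) m (T ω) := by
    rw [← Pi.add_apply, ← Pi.add_apply, ← birkhoffAverage_add, Set.indicator_self_add_compl]
  have h2 : ∫ x, f (ξ x) ∂μ = ∫ x, (ξ ⁻¹' A).indicator (f ∘ ξ) x ∂μ +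
      ∫ x, (ξ ⁻¹' A)ᶜ.indicator (f ∘ ξ) x ∂μ := by
    rw [integral_indicator hAm, integral_indicator hAm.compl, integral_add_compl hAm hi]
    rfl
  rw [h1, h2, add_sub_add_comm, add_comm]
  exact (abs_add_le _ _).trans (add_le_add le_rfl (hm f hf hfb))

/-- A process with purely atomic marginal has asymptotically vanishing discrepancy. -/
theorem ae_eventually_discrepancy_le_of_measure_compl_eq_zero [MeasurableSingletonClass X]
    [IsProbabilityMeasure μ] (hT : Ergodic T μ) (hξ : Measurable ξ)
    (hFm : ∀ f ∈ F, Measurable f) (hFb : ∀ f ∈ F, ∀ x, f x ∈ Set.Icc (0 : ℝ) 1) {A : Set X}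
    (hA : A.Countable) (hA0 : μ (ξ ⁻¹' A)ᶜ = 0) :
    ∀ᵐ ω ∂μ, ∀ ε > 0, ∀ᶠ m in atTop, discrepancy μ T ξ F m ω ≤ ε := by
  have hAm : MeasurableSet (ξ ⁻¹' A)ᶜ := (hξ hA.measurableSet).compl
  filter_upwards [ae_eventually_abs_birkhoffAverage_sub_integral_le_add hT hξ hA,
    ae_tendsto_birkhoffAverage_indicator hT hAm] with ω h1 h2 ε hε
  rw [measureReal_def, hA0, ENNReal.toReal_zero] at h2
  filter_upwards [h1 (ε / 2) (half_pos hε), h2.eventually_lt_const (half_pos hε)] with m h1 h2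
  refine discrepancy_le hε.le fun f hf => (h1 f (hFm f hf) (hFb f hf)).trans ?_
  have hle : (ξ ⁻¹' A)ᶜ.indicator (f ∘ ξ) ≤ (ξ ⁻¹' A)ᶜ.indicator fun _ => (1 : ℝ) :=
    fun x => Set.indicator_le_indicator (hFb f hf (ξ x)).2
  have h3 := birkhoffAverage_mono T hle m (T ω)
  have h4 := birkhoffAverage_nonneg T (φ := (ξ ⁻¹' A)ᶜ.indicator (f ∘ ξ))
    (Set.indicator_nonneg fun x _ => (hFb f hf (ξ x)).1) m (T ω)
  rw [integral_indicator hAm, setIntegral_measure_zero _ hA0, sub_zero, abs_of_nonneg h4]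
  linarith

theorem measureReal_mul_integral_cond [IsFiniteMeasure μ] {B : Set Ω} (hB : MeasurableSet B)
    (hB0 : μ B ≠ 0) (g : Ω → ℝ) :
    μ.real B * ∫ x, g x ∂μ[|B] = ∫ x, B.indicator g x ∂μ := by
  rw [integral_indicator hB, ProbabilityTheory.cond, integral_smul_measure,
    ENNReal.toReal_inv, smul_eq_mul, ← measureReal_def, mul_inv_cancel_left₀]
  exact (ENNReal.toReal_pos hB0 (measure_ne_top μ B)).ne'

/-- Up to a vanishing error, the discrepancy of a process is bounded by that of the process
induced on the complement of a countable set of states, at the number of visits there. -/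
theorem IsFirstReturn.ae_exists_discrepancy_le [MeasurableSingletonClass X]
    [IsProbabilityMeasure μ] (hT : Ergodic T μ) (hξ : Measurable ξ)
    (hFm : ∀ f ∈ F, Measurable f) (hFb : ∀ f ∈ F, ∀ x, f x ∈ Set.Icc (0 : ℝ) 1) {A : Set X}
    (hA : A.Countable) (hA0 : μ (ξ ⁻¹' A)ᶜ ≠ 0) {G : Ω → Ω}
    (hG : IsFirstReturn T (ξ ⁻¹' A)ᶜ G) :
    ∀ᵐ ω ∂μ, ∃ N : ℕ → ℕ, Tendsto N atTop atTop ∧ ∀ ε > 0, ∀ᶠ m in atTop,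
      discrepancy μ T ξ F m ω ≤ discrepancy μ[|(ξ ⁻¹' A)ᶜ] G ξ F (N m) ω + ε := by
  have hAm : MeasurableSet (ξ ⁻¹' A)ᶜ := (hξ hA.measurableSet).compl
  have : IsProbabilityMeasure μ[|(ξ ⁻¹' A)ᶜ] := cond_isProbabilityMeasure hA0
  filter_upwards [ae_eventually_abs_birkhoffAverage_sub_integral_le_add hT hξ hA,
    ae_tendsto_birkhoffAverage_indicator hT hAm] with ω h1 h2
  choose N hN hsum using fun m => hG.exists_birkhoffSum_eq m ω
  refine ⟨N, ?_, fun ε hε => ?_⟩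
  · rw [← tendsto_natCast_atTop_iff (R := ℝ)]
    refine (h2.pos_mul_atTop (ENNReal.toReal_pos hA0 (measure_ne_top _ _))
      (tendsto_natCast_atTop_atTop (R := ℝ))).congr fun m => ?_
    rw [mul_comm, natCast_mul_birkhoffAverage, hN]
  · have h3 := (h2.sub_const (μ.real (ξ ⁻¹' A)ᶜ)).abs
    rw [sub_self, abs_zero] at h3
    filter_upwards [h1 (ε / 2) (half_pos hε), h3.eventually_lt_const (half_pos hε)] with m h1 h3
    refine discrepancy_le (add_nonneg (discrepancy_nonneg _ _ _ _ _ _) hε.le) fun f hf => ?_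
    refine (h1 f (hFm f hf) (hFb f hf)).trans ?_
    have hD := le_discrepancy (μ := μ[|(ξ ⁻¹' A)ᶜ]) (T := G) (ξ := ξ) hFb hf (N m) ω
    have hp0 : 0 ≤ birkhoffAverage ℝ T ((ξ ⁻¹' A)ᶜ.indicator fun _ => (1 : ℝ)) m (T ω) :=
      birkhoffAverage_nonneg T (Set.indicator_nonneg fun _ _ => zero_le_one) m _
    have hp1 : birkhoffAverage ℝ T ((ξ ⁻¹' A)ᶜ.indicator fun _ => (1 : ℝ)) m (T ω) ≤ 1 :=
      birkhoffAverage_le_one T (Set.indicator_le_self' fun _ _ => zero_le_one) m _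
    have havg : birkhoffAverage ℝ T ((ξ ⁻¹' A)ᶜ.indicator (f ∘ ξ)) m (T ω) =
        birkhoffAverage ℝ T ((ξ ⁻¹' A)ᶜ.indicator fun _ => (1 : ℝ)) m (T ω) *
          birkhoffAverage ℝ G (f ∘ ξ) (N m) (G ω) := by
      rw [birkhoffAverage, hsum, birkhoffAverage, hN, smul_eq_mul, smul_eq_mul, mul_assoc,
        natCast_mul_birkhoffAverage]
    have hJ0 : 0 ≤ ∫ x, f (ξ x) ∂μ[|(ξ ⁻¹' A)ᶜ] := integral_nonneg fun x => (hFb f hf _).1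
    have hJ1 : ∫ x, f (ξ x) ∂μ[|(ξ ⁻¹' A)ᶜ] ≤ 1 := by
      have := integral_mono (integrable_comp_of_mem_Icc (μ := μ[|(ξ ⁻¹' A)ᶜ]) hξ (hFm f hf)
        (hFb f hf)) (integrable_const (1 : ℝ)) fun x => (hFb f hf (ξ x)).2
      simpa using this
    rw [havg, ← measureReal_mul_integral_cond hAm hA0]
    simp only [comp_apply] at hD ⊢
    set p := birkhoffAverage ℝ T ((ξ ⁻¹' A)ᶜ.indicator fun _ => (1 : ℝ)) m (T ω)
    set J := ∫ x, f (ξ x) ∂μ[|(ξ ⁻¹' A)ᶜ]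
    set a := birkhoffAverage ℝ G (f ∘ ξ) (N m) (G ω)
    set b := μ.real (ξ ⁻¹' A)ᶜ
    have hsplit : p * a - b * J = p * (a - J) + (p - b) * J := by ring
    have hb1 : |p * (a - J)| ≤ |a - J| := by
      rw [abs_mul, abs_of_nonneg hp0]
      exact mul_le_of_le_one_left (abs_nonneg _) hp1
    have hb2 : |(p - b) * J| ≤ |p - b| := by
      rw [abs_mul, abs_of_nonneg hJ0]
      exact mul_le_of_le_one_right (abs_nonneg _) hJ1
    rw [hsplit]
    linarith [abs_add_le (p * (a - J)) ((p - b) * J)]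

end Discrepancy

theorem exists_nonatomic_process_with_large_discrepancy
    {X : Type u} {Ω : Type v} [MetricSpace X] [CompleteSpace X]
    [TopologicalSpace.SeparableSpace X] [MeasurableSpace X] [BorelSpace X]
    [MeasurableSpace Ω] (μ : Measure Ω) [IsProbabilityMeasure μ]
    (T : Ω → Ω) (ξ : Ω → X) (hT : Ergodic T μ) (hξ : Measurable ξ)
    (F : Set (X → ℝ)) (hFc : F.Countable)
    (hFm : ∀ f ∈ F, Measurable f)
    (hFb : ∀ f ∈ F, ∀ x, f x ∈ Set.Icc (0 : ℝ) 1)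
    (η : ℝ) (hη : 0 < η)
    (hΓ : ∀ᵐ ω ∂μ, η < Filter.limsup (fun m : ℕ => discrepancy μ T ξ F m ω) Filter.atTop) :
    Uncountable X ∧
    ∃ (Ω' : Type u) (_ : MeasurableSpace Ω') (μ' : Measure Ω')
      (T' : Ω' → Ω') (ξ' : Ω' → X),
      IsProbabilityMeasure μ' ∧ Ergodic T' μ' ∧ Measurable ξ' ∧
      (∀ x : X, μ'.map ξ' {x} = 0) ∧
      (∀ᵐ ω ∂μ', η < Filter.limsup (fun m : ℕ => discrepancy μ' T' ξ' F m ω) Filter.atTop) := by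
  have := μ.nonempty_of_neZero
  obtain ⟨A, hAdef⟩ : ∃ A : Set X, A = {x | 0 < μ {ω | ξ ω = x}} := ⟨_, rfl⟩
  have hA : A.Countable := hAdef ▸ Measure.countable_meas_level_set_pos hξ
  have hB : MeasurableSet (ξ ⁻¹' A)ᶜ := (hξ hA.measurableSet).compl
  have hB0 : μ (ξ ⁻¹' A)ᶜ ≠ 0 := by
    intro hB0
    obtain ⟨ω, h1, h2⟩ := (hΓ.and
      (ae_eventually_discrepancy_le_of_measure_compl_eq_zero hT hξ hFm hFb hA hB0)).exists
    obtain ⟨m, h3, h4⟩ := ((frequently_lt_discrepancy h1).and_eventually (h2 η hη)).exists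
    exact h3.not_ge h4
  obtain ⟨G, hGm, hG⟩ := exists_measurable_isFirstReturn hT.measurable hB
  have hprob : IsProbabilityMeasure μ[|(ξ ⁻¹' A)ᶜ] := cond_isProbabilityMeasure hB0
  have hGerg := hG.ergodic_cond hT hGm hB
  have hlim : ∀ᵐ ω ∂μ[|(ξ ⁻¹' A)ᶜ],
      η < limsup (fun m : ℕ => discrepancy μ[|(ξ ⁻¹' A)ᶜ] G ξ F m ω) atTop := by
    refine cond_absolutelyContinuous.ae_le ?_
    filter_upwards [hΓ, hG.ae_exists_discrepancy_le hT hξ hFm hFb hA hB0] with ω h1 ⟨N, hN, h2⟩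
    obtain ⟨c, hc, hcl⟩ := exists_between h1
    obtain ⟨d, hd, hdc⟩ := exists_between hc
    refine hd.trans_le (le_limsup_discrepancy hFb (hN.frequently ?_))
    refine ((frequently_lt_discrepancy hcl).and_eventually (h2 (c - d) (sub_pos.mpr hdc))).mono ?_
    rintro m ⟨h3, h4⟩
    linarith
  obtain ⟨ν, S, ζ, hν, hS, hζ, hmap, hlimν⟩ :=
    exists_sequence_process_with_large_discrepancy hGerg hξ hFc hFm hlim
  have hatom : ∀ x : X, ν.map ζ {x} = 0 := by
    intro x
    rw [hmap, Measure.map_apply hξ (measurableSet_singleton x), cond_apply hB]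
    refine mul_eq_zero_of_right _ ?_
    by_cases hx : x ∈ A
    · convert measure_empty (μ := μ)
      refine Set.eq_empty_of_forall_notMem ?_
      rintro ω ⟨h1, h2⟩
      rw [Set.mem_preimage, Set.mem_singleton_iff] at h2
      exact h1 (by rwa [Set.mem_preimage, h2])
    · rw [hAdef, Set.mem_ofPred_eq, not_lt, nonpos_iff_eq_zero] at hx
      exact measure_mono_null Set.inter_subset_right hx
  refine ⟨⟨fun hX => ?_⟩, ℕ → X, inferInstance, ν, S, ζ, hν, hS, hζ, hatom, hlimν⟩
  have : IsProbabilityMeasure (ν.map ζ) := Measure.isProbabilityMeasure_map hζ.aemeasurable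
  refine IsProbabilityMeasure.ne_zero (ν.map ζ) (Measure.measure_univ_eq_zero.mp ?_)
  rw [← Set.biUnion_of_singleton Set.univ]
  exact (measure_biUnion_null_iff Set.countable_univ).mpr fun x _ => hatom x
end

section
/- Let γ > 0 and let K = ⌊1/γ⌋ + 1 if 1/γ is not an integer, and K = 1/γ otherwise. Let F be a family of functions f : [0,1] → [0,1], let L ≥ 1, and suppose there exist a sub-family F₀ ⊆ F with exactly 2^L elements and integers k, k' ∈ {1,…,K} with |k − k'| ≥ 2 such that for every choice function ε : F₀ → {k, k'}, the intersection ⋂_{f ∈ F₀} s_{ε(f)}(f) is non-empty. Then F (γ/2)-shatters some subset of [0,1] of cardinality L, i.e., dim_{γ/2}(F) ≥ L. -/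
open MeasureTheory unitInterval

/-- `F` γ-shatters the finite set `D`. -/
def GammaShatters {X : Type*} (F : Set (X → ℝ)) (γ : ℝ) (D : Finset X) : Prop :=
  ∃ α : ℝ, ∀ D₀ ⊆ D, ∃ f ∈ F,
    (∀ x ∈ D₀, f x > α + γ) ∧ (∀ x ∈ D, x ∉ D₀ → f x < α - γ)

/-- `K = ⌊1/γ⌋ + 1` if `1/γ` is not an integer, and `K = 1/γ` otherwise. -/
noncomputable def gapK (γ : ℝ) : ℕ :=
  if (1 / γ : ℝ) = (⌊(1 : ℝ) / γ⌋₊ : ℝ) then ⌊(1 : ℝ) / γ⌋₊ else ⌊(1 : ℝ) / γ⌋₊ + 1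

/-- The `k`-th γ-segment of `f` (for `1 ≤ k ≤ K`):
`s_k(f) = f⁻¹[(k−1)γ, kγ)` for `k < K` and `s_K(f) = f⁻¹[(K−1)γ, 1]`. -/
def gammaSegment {X : Type*} (γ : ℝ) (K : ℕ) (f : X → ℝ) (k : ℕ) : Set X :=
  if k = K then f ⁻¹' Set.Icc (((K : ℝ) - 1) * γ) 1
  else f ⁻¹' Set.Ico (((k : ℝ) - 1) * γ) ((k : ℝ) * γ)

/-- Finitely many reals below `b` are bounded above by some `m < b`. -/
theorem exists_lt_forall_lt_of_finite {ι : Type*} [Finite ι] (v : ι → ℝ) (b : ℝ) :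
    ∃ m < b, ∀ i, v i < b → v i < m := by
  have h : ∀ᶠ m in nhdsWithin b (Set.Iio b), ∀ i, v i < b → v i < m := by
    refine Filter.eventually_all.2 fun i => ?_
    by_cases hi : v i < b
    · filter_upwards [Ioo_mem_nhdsLT hi] with m hm _ using hm.1
    · exact Filter.Eventually.of_forall fun _ h => absurd h hi
  obtain ⟨m, hm, hmb⟩ := (h.and self_mem_nhdsWithin).exists
  exact ⟨m, hmb, hm⟩

/-- If `2 ^ L` functions of `F` realize every pattern of values below `b` and at least `b + γ`,
then `F` shatters a set of `L` points at scale `γ / 2`. -/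
theorem exists_gammaShatters_of_forall_pattern {X : Type*} {γ b : ℝ} (hγ : 0 ≤ γ)
    {F : Set (X → ℝ)} {L : ℕ} {F₀ : Finset (X → ℝ)} (hF₀F : ↑F₀ ⊆ F)
    (hF₀card : F₀.card = 2 ^ L)
    (hpattern : ∀ S : Set (X → ℝ), ∃ x : X, ∀ f ∈ F₀,
      (f ∈ S → b + γ ≤ f x) ∧ (f ∉ S → f x < b)) :
    ∃ D : Finset X, D.card = L ∧ GammaShatters F (γ / 2) D := by
  classical
  have e : F₀ ≃ Finset (Fin L) := Fintype.equivOfCardEq (by simp [hF₀card])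
  choose x hx using fun i : Fin L => hpattern {f | ∃ hf : f ∈ F₀, i ∈ e ⟨f, hf⟩}
  have hhigh (T : Finset (Fin L)) (i : Fin L) (hi : i ∈ T) :
      b + γ ≤ (e.symm T : X → ℝ) (x i) :=
    (hx i _ (e.symm T).2).1 ⟨(e.symm T).2, by simpa using hi⟩
  have hlow (T : Finset (Fin L)) (i : Fin L) (hi : i ∉ T) :
      (e.symm T : X → ℝ) (x i) < b :=
    (hx i _ (e.symm T).2).2 (by rintro ⟨_, h⟩; exact hi (by simpa using h))
  have hinj : Function.Injective x := by
    intro i j hij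
    by_contra hne
    have h₁ := hhigh {i} i (by simp)
    have h₂ := hlow {i} j (by simpa using Ne.symm hne)
    rw [hij] at h₁
    linarith
  obtain ⟨m, hmb, hm⟩ := exists_lt_forall_lt_of_finite
    (fun p : Finset (Fin L) × Fin L => (e.symm p.1 : X → ℝ) (x p.2)) b
  refine ⟨Finset.univ.image x, by simp [Finset.card_image_of_injective _ hinj],
    m + γ / 2, fun D₀ hD₀ => ?_⟩
  let T : Finset (Fin L) := {i | x i ∈ D₀}
  refine ⟨e.symm T, hF₀F (e.symm T).2, fun y hy => ?_, fun y hyD hy => ?_⟩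
  · obtain ⟨i, -, rfl⟩ := Finset.mem_image.1 (hD₀ hy)
    linarith [hhigh T i (by simpa [T] using hy)]
  · obtain ⟨i, -, rfl⟩ := Finset.mem_image.1 hyD
    linarith [hm (T, i) (hlow T i (by simpa [T] using hy))]

theorem lt_of_mem_gammaSegment {X : Type*} {γ : ℝ} {K k : ℕ} {f : X → ℝ} {x : X}
    (hk : k ≠ K) (hx : x ∈ gammaSegment γ K f k) : f x < k * γ := by
  rw [gammaSegment, if_neg hk] at hx
  exact hx.2

theorem le_of_mem_gammaSegment {X : Type*} {γ : ℝ} {K k : ℕ} {f : X → ℝ} {x : X}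
    (hx : x ∈ gammaSegment γ K f k) : ((k : ℝ) - 1) * γ ≤ f x := by
  unfold gammaSegment at hx
  split_ifs at hx with h
  · exact h ▸ hx.1
  · exact hx.1

theorem shatters_of_full_join
    (γ : ℝ) (hγ : 0 < γ)
    (F : Set (unitInterval → ℝ)) (hFb : ∀ f ∈ F, ∀ x, f x ∈ Set.Icc (0 : ℝ) 1)
    (L : ℕ) (hL : 1 ≤ L)
    (F₀ : Finset (unitInterval → ℝ)) (hF₀F : ↑F₀ ⊆ F) (hF₀card : F₀.card = 2 ^ L)
    (k k' : ℕ) (hk1 : 1 ≤ k) (hkK : k ≤ gapK γ) (hk'1 : 1 ≤ k') (hk'K : k' ≤ gapK γ)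
    (hnonadj : 2 ≤ |(k : ℤ) - (k' : ℤ)|)
    (hjoin : ∀ ε : (unitInterval → ℝ) → ℕ, (∀ f ∈ F₀, ε f = k ∨ ε f = k') →
      (⋂ f ∈ F₀, gammaSegment γ (gapK γ) f (ε f)).Nonempty) :
    ∃ D : Finset unitInterval, D.card = L ∧ GammaShatters F (γ / 2) D := by
  classical
  wlog hlt : k < k' generalizing k k'
  · have hne : k ≠ k' := by rintro rfl; simp at hnonadj
    exact this k' k hk'1 hk'K hk1 hkK (by rwa [abs_sub_comm])
      (fun ε hε => hjoin ε fun f hf => (hε f hf).symm) (by omega)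
  have hgap : k + 2 ≤ k' := by
    rw [abs_of_neg (by omega)] at hnonadj
    omega
  have hgap' : (k : ℝ) + 2 ≤ k' := by exact_mod_cast hgap
  refine exists_gammaShatters_of_forall_pattern (b := k * γ) hγ.le hF₀F hF₀card fun S => ?_
  obtain ⟨x, hx⟩ := hjoin (fun f => if f ∈ S then k' else k)
    fun f _ => by by_cases h : f ∈ S <;> simp [h]
  refine ⟨x, fun f hf => ?_⟩
  have hxf := Set.mem_iInter₂.1 hx f hf
  refine ⟨fun h => ?_, fun h => ?_⟩
  · rw [if_pos h] at hxf
    nlinarith [le_of_mem_gammaSegment hxf]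
  · rw [if_neg h] at hxf
    exact lt_of_mem_gammaSegment (by omega) hxf
end

section
/- Model the complete binary tree of depth L by binary strings: the nodes at level l are the strings in {0,1}^l, the children of a node s are s0 and s1, and the leaves are the strings of length L. Say a node s covers a set S of leaves if s is a prefix of some element of S. Let 0 < c < 1 and let S be a set of leaves with |S| ≥ c·2^L ≥ 4, and set u = ⌈log₂(1/c) + 1⌉. Then there exist an integer l₀ with L − u ≤ l₀ ≤ L − 1 and a set S' of nodes at level l₀ such that for every s ∈ S' both children s0 and s1 cover S, and |S'| ≥ c·2^L / (4L). -/
/-- A node `s` of the binary tree (a binary string) covers a set `S` of leaves if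
`s` is a prefix of some element of `S`. -/
def Covers (s : List Bool) (S : Finset (List Bool)) : Prop :=
  ∃ t ∈ S, s <+: t

/-- The nodes at level `l` (the strings of length `l`) that cover a set `S` of leaves. -/
def coveringNodes (S : Finset (List Bool)) (l : ℕ) : Finset (List Bool) :=
  S.image (List.take l)

/-- The nodes at level `l` both of whose children cover `S`. -/
def doubleAncestors (S : Finset (List Bool)) (l : ℕ) : Finset (List Bool) :=
  (coveringNodes S l).filter fun s =>
    s ++ [false] ∈ coveringNodes S (l + 1) ∧ s ++ [true] ∈ coveringNodes S (l + 1)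

theorem covers_of_mem_coveringNodes {S : Finset (List Bool)} {l : ℕ} {s : List Bool}
    (hs : s ∈ coveringNodes S l) : Covers s S := by
  obtain ⟨t, ht, rfl⟩ := Finset.mem_image.1 hs
  exact ⟨t, ht, List.take_prefix l t⟩

theorem coveringNodes_length {S : Finset (List Bool)} {L : ℕ} (hS : ∀ t ∈ S, t.length = L) :
    coveringNodes S L = S := by
  ext s
  simp only [coveringNodes, Finset.mem_image]
  constructor
  · rintro ⟨t, ht, rfl⟩
    rwa [List.take_of_length_le (hS t ht).le]
  · exact fun hs => ⟨s, hs, List.take_of_length_le (hS s hs).le⟩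

theorem card_coveringNodes_succ_le {S : Finset (List Bool)} {L : ℕ}
    (hS : ∀ t ∈ S, t.length = L) {l : ℕ} (hl : l < L) :
    (coveringNodes S (l + 1)).card ≤ (coveringNodes S l).card + (doubleAncestors S l).card := by
  let A : Bool → Finset (List Bool) := fun b =>
    (coveringNodes S l).filter fun s => s ++ [b] ∈ coveringNodes S (l + 1)
  have hsub : coveringNodes S (l + 1) ⊆
      (A false).image (· ++ [false]) ∪ (A true).image (· ++ [true]) := by
    intro s hs
    obtain ⟨t, ht, hst⟩ := Finset.mem_image.1 hs
    have hlt : l < t.length := by rw [hS t ht]; exact hl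
    have hs' : t.take l ++ [t[l]] = s := by rw [← hst, List.take_append_getElem]
    have hA : t.take l ∈ A t[l] := by
      refine Finset.mem_filter.2 ⟨Finset.mem_image_of_mem _ ht, ?_⟩
      rwa [hs']
    rw [Finset.mem_union, Finset.mem_image, Finset.mem_image]
    generalize t[l] = b at hs' hA
    cases b
    · exact Or.inl ⟨_, hA, hs'⟩
    · exact Or.inr ⟨_, hA, hs'⟩
  have hunion : A false ∪ A true ⊆ coveringNodes S l :=
    Finset.union_subset (Finset.filter_subset _ _) (Finset.filter_subset _ _)
  have hinter : A false ∩ A true = doubleAncestors S l := by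
    simp only [A, doubleAncestors, Finset.filter_and]
  calc (coveringNodes S (l + 1)).card
      ≤ (A false).card + (A true).card :=
        (Finset.card_le_card hsub).trans <| (Finset.card_union_le _ _).trans <|
          add_le_add Finset.card_image_le Finset.card_image_le
    _ = (A false ∪ A true).card + (A false ∩ A true).card :=
        (Finset.card_union_add_card_inter _ _).symm
    _ ≤ _ := by
        rw [hinter]
        exact Nat.add_le_add_right (Finset.card_le_card hunion) _

theorem card_coveringNodes_le_two_pow {S : Finset (List Bool)} {L : ℕ}
    (hS : ∀ t ∈ S, t.length = L) {l : ℕ} (hl : l ≤ L) :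
    (coveringNodes S l).card ≤ 2 ^ l := by
  induction l with
  | zero =>
    have h : coveringNodes S 0 ⊆ {[]} := by
      intro s hs
      obtain ⟨t, -, rfl⟩ := Finset.mem_image.1 hs
      simp
    simpa using Finset.card_le_card h
  | succ l ih =>
    have h₁ := card_coveringNodes_succ_le hS hl
    have h₂ : (doubleAncestors S l).card ≤ (coveringNodes S l).card :=
      Finset.card_le_card (Finset.filter_subset _ _)
    have h₃ := ih (by omega)
    rw [pow_succ]
    omega

theorem exists_level_with_many_double_ancestors
    (L : ℕ) (c : ℝ) (hc0 : 0 < c) (hc1 : c < 1)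
    (S : Finset (List Bool)) (hleaf : ∀ t ∈ S, t.length = L)
    (hcard : c * 2 ^ L ≤ (S.card : ℝ)) (h4 : (4 : ℝ) ≤ c * 2 ^ L) :
    ∃ l₀ : ℕ, (L : ℤ) - ⌈Real.logb 2 (1 / c) + 1⌉ ≤ (l₀ : ℤ) ∧ l₀ ≤ L - 1 ∧
      ∃ S' : Finset (List Bool),
        (∀ s ∈ S', s.length = l₀) ∧
        (∀ s ∈ S', Covers (s ++ [false]) S ∧ Covers (s ++ [true]) S) ∧
        c * 2 ^ L / (4 * L) ≤ (S'.card : ℝ) := by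
  have hlog : 0 < Real.logb 2 (1 / c) :=
    Real.logb_pos (by norm_num) ((one_lt_div hc0).2 hc1)
  have hlogL2 : Real.logb 2 (1 / c) + 1 ≤ L := by
    rw [← le_sub_iff_add_le, Real.logb_le_iff_le_rpow (by norm_num) (by positivity),
      Real.rpow_sub (by norm_num), Real.rpow_natCast, Real.rpow_one, div_le_iff₀ hc0]
    linarith
  obtain ⟨u, hu⟩ : ∃ u : ℕ, ⌈Real.logb 2 (1 / c) + 1⌉ = (u : ℤ) :=
    Int.eq_ofNat_of_zero_le (Int.ceil_nonneg (by linarith))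
  have huL : u ≤ L := by
    have : ⌈Real.logb 2 (1 / c) + 1⌉ ≤ (L : ℤ) := Int.ceil_le.2 (by exact_mod_cast hlogL2)
    omega
  have hlogu : Real.logb 2 (1 / c) + 1 ≤ u := by
    have := Int.le_ceil (Real.logb 2 (1 / c) + 1)
    rw [hu] at this
    exact_mod_cast this
  have hpow : 2 ≤ c * 2 ^ u := by
    rw [← le_sub_iff_add_le, Real.logb_le_iff_le_rpow (by norm_num) (by positivity),
      Real.rpow_sub (by norm_num), Real.rpow_natCast, Real.rpow_one, div_le_iff₀ hc0] at hlogu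
    linarith
  obtain ⟨m, rfl⟩ := Nat.exists_eq_add_of_le' huL
  set x : ℝ := c * 2 ^ (m + u) / (4 * ((m + u : ℕ) : ℝ)) with hx
  have hx0 : 0 ≤ x := by positivity
  obtain ⟨l, hml, hlL, hlx⟩ :
      ∃ l, m ≤ l ∧ l < m + u ∧ x ≤ ((doubleAncestors S l).card : ℝ) := by
    by_contra! hsmall
    have hgrow : ∀ k ≤ u, ((coveringNodes S (m + k)).card : ℝ) ≤ 2 ^ m + k * x := by
      intro k hk
      induction k with
      | zero =>
        have h := card_coveringNodes_le_two_pow hleaf (l := m) (by omega)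
        simpa using (by exact_mod_cast h : ((coveringNodes S m).card : ℝ) ≤ 2 ^ m)
      | succ k ih =>
        have h₁ : ((coveringNodes S (m + k + 1)).card : ℝ) ≤
            (coveringNodes S (m + k)).card + (doubleAncestors S (m + k)).card := by
          exact_mod_cast card_coveringNodes_succ_le hleaf (by omega)
        have h₂ := hsmall (m + k) (by omega) (by omega)
        have h₃ := ih (by omega)
        rw [← add_assoc]
        push_cast
        linarith
    have hS := hgrow u le_rfl
    rw [coveringNodes_length hleaf] at hS
    have hm : (2 : ℝ) * 2 ^ m ≤ c * 2 ^ (m + u) := by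
      rw [pow_add]
      nlinarith [pow_pos (two_pos : (0 : ℝ) < 2) m]
    have hL0 : (0 : ℝ) < ((m + u : ℕ) : ℝ) := by linarith
    have hux : (u : ℝ) * x ≤ c * 2 ^ (m + u) / 4 := by
      calc (u : ℝ) * x ≤ ((m + u : ℕ) : ℝ) * x := by gcongr
        _ = c * 2 ^ (m + u) / 4 := by rw [hx]; field_simp
    linarith
  refine ⟨l, by omega, by omega, doubleAncestors S l, fun s hs => ?_, fun s hs => ?_, hlx⟩
  · obtain ⟨t, ht, rfl⟩ := Finset.mem_image.1 (Finset.mem_filter.1 hs).1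
    rw [List.length_take, hleaf t ht]
    omega
  · exact (Finset.mem_filter.1 hs).2.imp covers_of_mem_coveringNodes covers_of_mem_coveringNodes
end

section
/- Let F be a countable regular family of Borel measurable functions f : [0,1] → [0,1], and let X₁, X₂, … be a stationary ergodic process with values in [0,1] whose marginal distribution is Lebesgue measure, such that almost surely limsup_{m→∞} Γ_m(F) > η for some η > 0. Set γ = η/5 and let K = ⌊1/γ⌋ + 1 if 1/γ ∉ ℤ and K = 1/γ otherwise. Then for each L ≥ 1 there exist functions f₁, …, f_L ∈ F and integers k, k' ∈ {1,…,K} with |k − k'| ≥ 2, such that for every choice function ε : {1,…,L} → {k, k'} the intersection ⋂_{ℓ=1}^L s_{ε(ℓ)}(f_ℓ) has positive Lebesgue measure; in particular the join ⋁_{ℓ=1}^L {s_k(f_ℓ), s_{k'}(f_ℓ)} has the maximum cardinality 2^L. -/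
open MeasureTheory Filter unitInterval

/-- A set is a finite union of intervals (order-connected sets). -/
def FinUnionIntervals {X : Type*} [Preorder X] (s : Set X) : Prop :=
  ∃ S : Finset (Set X), (∀ J ∈ S, J.OrdConnected) ∧ s = ⋃₀ ↑S


open scoped Topology

namespace MaximalJoin

section Birkhoff

variable {Ω : Type*}

/-- The running maximum of the Birkhoff sums `S₁, …, Sₙ₊₁`, defined recursively. -/
noncomputable def runningMax (T : Ω → Ω) (g : Ω → ℝ) : ℕ → Ω → ℝ
  | 0, x => g x
  | n + 1, x => g x + max 0 (runningMax T g n (T x))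

theorem le_runningMax (T : Ω → Ω) (g : Ω → ℝ) (n : ℕ) (x : Ω) : g x ≤ runningMax T g n x := by
  cases n with
  | zero => exact le_rfl
  | succ n => exact le_add_of_nonneg_right (le_max_left _ _)

theorem runningMax_le_succ (T : Ω → Ω) (g : Ω → ℝ) (n : ℕ) (x : Ω) :
    runningMax T g n x ≤ runningMax T g (n + 1) x := by
  induction n generalizing x with
  | zero => exact le_runningMax T g 1 x
  | succ n ih => exact add_le_add_right (max_le_max le_rfl (ih (T x))) _

theorem birkhoffSum_succ_le_runningMax (T : Ω → Ω) (g : Ω → ℝ) (n : ℕ) (x : Ω) :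
    birkhoffSum T g (n + 1) x ≤ runningMax T g n x := by
  induction n generalizing x with
  | zero => simp [runningMax]
  | succ n ih =>
    rw [birkhoffSum_succ']
    exact add_le_add_right ((ih (T x)).trans (le_max_right _ _)) _

theorem runningMax_le {T : Ω → Ω} {g : Ω → ℝ} {C : ℝ} (hC : ∀ x, |g x| ≤ C) (n : ℕ) (x : Ω) :
    runningMax T g n x ≤ (n + 1) * C := by
  have hC0 : 0 ≤ C := (abs_nonneg _).trans (hC x)
  induction n generalizing x with
  | zero => simpa [runningMax] using (le_abs_self _).trans (hC x)
  | succ n ih =>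
    have h1 := (le_abs_self _).trans (hC x)
    have h2 : max 0 (runningMax T g n (T x)) ≤ (n + 1) * C :=
      max_le (by positivity) (ih (T x))
    simp only [runningMax]
    push_cast
    linarith

theorem tendsto_runningMax {T : Ω → Ω} {g : Ω → ℝ} {x : Ω}
    (hx : ¬ BddAbove (Set.range fun n => birkhoffSum T g n x)) :
    Tendsto (fun n => runningMax T g n x) atTop atTop := by
  refine tendsto_atTop_atTop_of_monotone (monotone_nat_of_le_succ fun n =>
    runningMax_le_succ T g n x) fun b => ?_
  by_contra! h
  refine hx ⟨max b 0, ?_⟩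
  rintro _ ⟨n, rfl⟩
  cases n with
  | zero => simp
  | succ n =>
    exact ((birkhoffSum_succ_le_runningMax T g n x).trans (h n).le).trans (le_max_left _ _)

variable [MeasurableSpace Ω] {μ : Measure Ω} {T : Ω → Ω}

theorem measurable_runningMax (hT : Measurable T) {g : Ω → ℝ} (hg : Measurable g) (n : ℕ) :
    Measurable (runningMax T g n) := by
  induction n with
  | zero => exact hg
  | succ n ih => exact hg.add (measurable_const.max (ih.comp hT))

theorem measurable_birkhoffSum (hT : Measurable T) {g : Ω → ℝ} (hg : Measurable g) (n : ℕ) :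
    Measurable (birkhoffSum T g n) :=
  Finset.measurable_fun_sum _ fun i _ => hg.comp (hT.iterate i)

theorem ae_bddAbove_birkhoffSum [IsProbabilityMeasure μ] (hT : Ergodic T μ) {g : Ω → ℝ}
    (hg : Measurable g) {C : ℝ} (hC : ∀ x, |g x| ≤ C) (hneg : ∫ x, g x ∂μ < 0) :
    ∀ᵐ x ∂μ, BddAbove (Set.range fun n => birkhoffSum T g n x) := by
  have hTm := hT.measurable
  set E := {x | BddAbove (Set.range fun n => birkhoffSum T g n x)} with hE
  have hEm : MeasurableSet E := measurableSet_bddAbove_range (measurable_birkhoffSum hTm hg)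
  have hinv : T ⁻¹' E = E := by
    ext x
    constructor
    · rintro ⟨b, hb⟩
      refine ⟨max 0 (g x + b), ?_⟩
      rintro _ ⟨n, rfl⟩
      cases n with
      | zero => simp
      | succ n =>
        refine le_trans ?_ (le_max_right _ _)
        simp only [birkhoffSum_succ']
        exact add_le_add_right (hb ⟨n, rfl⟩) _
    · rintro ⟨b, hb⟩
      refine ⟨b - g x, ?_⟩
      rintro _ ⟨n, rfl⟩
      have := hb ⟨n + 1, rfl⟩
      simp only [birkhoffSum_succ'] at this
      simp only
      linarith
  refine (hT.toPreErgodic.ae_mem_or_ae_notMem hEm hinv).resolve_right fun hunb => ?_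
  have hbound (n : ℕ) (x : Ω) : |runningMax T g n x| ≤ (n + 1) * C := by
    have h0 : 0 ≤ C := (abs_nonneg _).trans (hC x)
    refine abs_le.2 ⟨?_, runningMax_le hC n x⟩
    have h1 := neg_le_of_abs_le (hC x)
    have h2 := le_runningMax T g n x
    have h3 : 0 ≤ n * C := by positivity
    linarith
  have hint (n : ℕ) : Integrable (runningMax T g n) μ :=
    Integrable.of_bound (measurable_runningMax hTm hg n).aestronglyMeasurable ((n + 1) * C)
      (ae_of_all _ fun x => hbound n x)
  have hlim : Tendsto (fun n => ∫ x, (runningMax T g (n + 1) x - runningMax T g n (T x)) ∂μ) atTop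
      (𝓝 (∫ x, g x ∂μ)) := by
    refine tendsto_integral_of_dominated_convergence (fun _ => 2 * C)
      (fun n => ((measurable_runningMax hTm hg (n + 1)).sub
        ((measurable_runningMax hTm hg n).comp hTm)).aestronglyMeasurable)
      (integrable_const _) (fun n => ae_of_all _ fun x => ?_) ?_
    · have h1 := abs_le.1 (hC x)
      have h2 := abs_le.1 (hC (T x))
      have h3 := le_runningMax T g n (T x)
      rw [Real.norm_eq_abs, abs_le]
      simp only [runningMax]
      rcases max_cases 0 (runningMax T g n (T x)) with h | h <;> rw [h.1] <;>
        constructor <;> linarith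
    · filter_upwards [hT.quasiMeasurePreserving.ae hunb] with x hx
      refine tendsto_const_nhds.congr' ?_
      filter_upwards [(tendsto_runningMax hx).eventually_ge_atTop 0] with n hn
      simp [runningMax, max_eq_right hn]
  refine hneg.not_ge (ge_of_tendsto' hlim fun n => ?_)
  have hintT : Integrable (fun x => runningMax T g n (T x)) μ :=
    hT.toMeasurePreserving.integrable_comp_of_integrable (hint n)
  rw [integral_sub (hint _) hintT, sub_nonneg]
  have : ∫ x, runningMax T g n (T x) ∂μ = ∫ x, runningMax T g n x ∂μ := by
    conv_rhs => rw [← hT.toMeasurePreserving.map_eq]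
    rw [integral_map hTm.aemeasurable (measurable_runningMax hTm hg n).aestronglyMeasurable]
  rw [this]
  exact integral_mono (hint n) (hint (n + 1)) (runningMax_le_succ T g n)

theorem ae_eventually_birkhoffAverage_le [IsProbabilityMeasure μ] (hT : Ergodic T μ) {g : Ω → ℝ}
    (hg : Measurable g) {C : ℝ} (hC : ∀ x, |g x| ≤ C) {δ : ℝ} (hδ : 0 < δ) :
    ∀ᵐ x ∂μ, ∀ᶠ n in atTop, birkhoffAverage ℝ T g n x ≤ ∫ x, g x ∂μ + δ := by
  have hi : Integrable g μ := Integrable.of_bound hg.aestronglyMeasurable C (ae_of_all _ hC)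
  set c := ∫ x, g x ∂μ + δ / 2 with hc
  have hint : ∫ x, (g x - c) ∂μ = - (δ / 2) := by
    rw [integral_sub hi (integrable_const _)]
    simp [hc]
  have hbd (x : Ω) : |g x - c| ≤ C + |c| := (abs_sub _ _).trans (add_le_add_left (hC x) _)
  filter_upwards [ae_bddAbove_birkhoffSum hT (hg.sub_const c) hbd (by rw [hint]; linarith)]
    with x ⟨b, hb⟩
  filter_upwards [(tendsto_natCast_atTop_atTop (R := ℝ)).eventually_ge_atTop (2 * b / δ),
    eventually_gt_atTop 0] with n hn hn0
  have hn0' : (0 : ℝ) < n := by exact_mod_cast hn0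
  have h1 : birkhoffSum T g n x - n * c ≤ b := by
    have := hb ⟨n, rfl⟩
    simpa [birkhoffSum, Finset.sum_sub_distrib] using this
  rw [div_le_iff₀ hδ] at hn
  rw [birkhoffAverage, smul_eq_mul, inv_mul_le_iff₀ hn0']
  rw [hc] at h1
  nlinarith

/-- Birkhoff's pointwise ergodic theorem for bounded functions. -/
theorem ae_tendsto_birkhoffAverage [IsProbabilityMeasure μ] (hT : Ergodic T μ) {g : Ω → ℝ}
    (hg : Measurable g) {C : ℝ} (hC : ∀ x, |g x| ≤ C) :
    ∀ᵐ x ∂μ, Tendsto (fun n => birkhoffAverage ℝ T g n x) atTop (𝓝 (∫ x, g x ∂μ)) := by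
  have hpos (k : ℕ) : (0 : ℝ) < 1 / (k + 1) := Nat.one_div_pos_of_nat
  have hup := ae_all_iff.2 fun k => ae_eventually_birkhoffAverage_le hT hg hC (hpos k)
  have hlow := ae_all_iff.2 fun k =>
    ae_eventually_birkhoffAverage_le hT hg.neg (C := C) (fun x => by simpa using hC x) (hpos k)
  filter_upwards [hup, hlow] with x h1 h2
  refine Metric.tendsto_atTop'.2 fun δ hδ => ?_
  obtain ⟨k, hk⟩ := exists_nat_one_div_lt hδ
  obtain ⟨N, hN⟩ := eventually_atTop.1 ((h1 k).and (h2 k))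
  refine ⟨N, fun n hn => ?_⟩
  obtain ⟨h3, h4⟩ := hN n hn.le
  simp only [Pi.neg_apply, integral_neg, birkhoffAverage_neg] at h4
  rw [Real.dist_eq, abs_lt]
  constructor <;> linarith

end Birkhoff

section Segments

theorem gapK_pos {γ : ℝ} (hγ : 0 < γ) : 1 ≤ gapK γ := by
  unfold gapK
  split_ifs with h
  · rw [Nat.one_le_iff_ne_zero]
    intro h0
    rw [h0] at h
    simp [hγ.ne'] at h
  · omega

theorem one_le_gapK_mul {γ : ℝ} (hγ : 0 < γ) : 1 ≤ gapK γ * γ := by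
  rw [← div_le_iff₀ hγ]
  unfold gapK
  split_ifs with h
  · exact h.le
  · push_cast
    exact (Nat.lt_floor_add_one _).le

theorem gapK_sub_one_mul_le {γ : ℝ} (hγ : 0 < γ) : ((gapK γ : ℝ) - 1) * γ ≤ 1 := by
  rw [← le_div_iff₀ hγ]
  have := Nat.floor_le (one_div_pos.2 hγ).le
  unfold gapK
  split_ifs with h
  · linarith
  · push_cast
    linarith

variable {X : Type*}

theorem gammaSegment_subset {γ : ℝ} (hγ : 0 < γ) (f : X → ℝ) (k : ℕ) :
    gammaSegment γ (gapK γ) f k ⊆ f ⁻¹' Set.Icc (((k : ℝ) - 1) * γ) (k * γ) := by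
  unfold gammaSegment
  split_ifs with h
  · subst h
    exact fun x hx => ⟨hx.1, hx.2.trans (one_le_gapK_mul hγ)⟩
  · exact fun x hx => ⟨hx.1, hx.2.le⟩

theorem exists_mem_gammaSegment {γ : ℝ} (hγ : 0 < γ) {f : X → ℝ} {x : X}
    (hx : f x ∈ Set.Icc (0 : ℝ) 1) :
    ∃ k ∈ Finset.Icc 1 (gapK γ), x ∈ gammaSegment γ (gapK γ) f k := by
  have h1 := Nat.floor_le (div_nonneg hx.1 hγ.le)
  have h2 := Nat.lt_floor_add_one (f x / γ)
  rw [le_div_iff₀ hγ] at h1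
  rw [div_lt_iff₀ hγ] at h2
  by_cases h : ⌊f x / γ⌋₊ + 1 < gapK γ
  · refine ⟨⌊f x / γ⌋₊ + 1, Finset.mem_Icc.2 ⟨by omega, h.le⟩, ?_⟩
    rw [gammaSegment, if_neg h.ne]
    exact ⟨by simpa using h1, by simpa using h2⟩
  · refine ⟨gapK γ, Finset.mem_Icc.2 ⟨gapK_pos hγ, le_rfl⟩, ?_⟩
    rw [gammaSegment, if_pos rfl]
    have h3 : (gapK γ : ℝ) ≤ ⌊f x / γ⌋₊ + 1 := by exact_mod_cast not_lt.1 h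
    exact ⟨le_trans (mul_le_mul_of_nonneg_right (by linarith) hγ.le) h1, hx.2⟩

variable [MeasurableSpace X]

theorem measurableSet_gammaSegment (γ : ℝ) (K : ℕ) {f : X → ℝ} (hf : Measurable f) (k : ℕ) :
    MeasurableSet (gammaSegment γ K f k) := by
  unfold gammaSegment
  split_ifs
  · exact hf measurableSet_Icc
  · exact hf measurableSet_Ico

/-- Both the `p.1`-st and the `p.2`-nd γ-segment of `f` meet `A` in positive measure. -/
def SplitBy (P : Measure X) (γ : ℝ) (f : X → ℝ) (p : ℕ × ℕ) (A : Set X) : Prop :=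
  0 < P (A ∩ gammaSegment γ (gapK γ) f p.1) ∧ 0 < P (A ∩ gammaSegment γ (gapK γ) f p.2)

/-- The pairs of indices of non-adjacent γ-segments. -/
noncomputable def gapPairs (γ : ℝ) : Finset (ℕ × ℕ) :=
  (Finset.Icc 1 (gapK γ) ×ˢ Finset.Icc 1 (gapK γ)).filter fun p => p.1 + 2 ≤ p.2

theorem exists_bracket_of_not_splitBy {P : Measure X} {γ : ℝ} (hγ : 0 < γ) {f : X → ℝ}
    (hf : ∀ x, f x ∈ Set.Icc (0 : ℝ) 1) {A : Set X}
    (hA : ∀ p ∈ gapPairs γ, ¬ SplitBy P γ f p A) :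
    ∃ l u : ℝ, 0 ≤ l ∧ l ≤ u ∧ u ≤ 1 ∧ u - l ≤ 2 * γ ∧ P (A ∩ {x | f x ∉ Set.Icc l u}) = 0 := by
  by_cases h : ∃ k, k ∈ Finset.Icc 1 (gapK γ) ∧ 0 < P (A ∩ gammaSegment γ (gapK γ) f k)
  · classical
    set k := Nat.find h with hk
    obtain ⟨hkK, hkA⟩ := Nat.find_spec h
    rw [← hk] at hkK hkA
    have hk1 : (1 : ℝ) ≤ k := by exact_mod_cast (Finset.mem_Icc.1 hkK).1
    have hk2 : (k : ℝ) ≤ gapK γ := by exact_mod_cast (Finset.mem_Icc.1 hkK).2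
    have hl1 : ((k : ℝ) - 1) * γ ≤ 1 :=
      (mul_le_mul_of_nonneg_right (by linarith) hγ.le).trans (gapK_sub_one_mul_le hγ)
    refine ⟨((k : ℝ) - 1) * γ, min ((k + 1) * γ) 1, mul_nonneg (by linarith) hγ.le,
      le_min (by nlinarith) hl1, min_le_right _ _, ?_, ?_⟩
    · have := min_le_left ((k + 1) * γ) 1
      linarith
    · refine measure_mono_null (t := ⋃ j ∈ (Finset.Icc 1 (gapK γ)).filter
        (fun j => j ≠ k ∧ j ≠ k + 1), A ∩ gammaSegment γ (gapK γ) f j) ?_ ?_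
      · rintro x ⟨hxA, hx⟩
        obtain ⟨j, hj, hxj⟩ := exists_mem_gammaSegment hγ (hf x)
        refine Set.mem_biUnion (Finset.mem_filter.2 ⟨hj, ?_, ?_⟩) ⟨hxA, hxj⟩
        · rintro rfl
          have := gammaSegment_subset hγ f _ hxj
          exact hx ⟨this.1, le_min (this.2.trans (by nlinarith)) (hf x).2⟩
        · rintro rfl
          have := gammaSegment_subset hγ f _ hxj
          push_cast at this
          exact hx ⟨le_trans (by nlinarith) this.1, le_min this.2 (hf x).2⟩
      · refine (measure_biUnion_null_iff (Finset.countable_toSet _)).2 fun j hj => ?_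
        obtain ⟨hjK, hj1, hj2⟩ := Finset.mem_filter.1 hj
        rcases lt_or_gt_of_ne hj1 with hlt | hgt
        · by_contra hne
          exact Nat.find_min h hlt ⟨hjK, pos_iff_ne_zero.2 hne⟩
        · by_contra hne
          exact hA (k, j) (Finset.mem_filter.2 ⟨Finset.mem_product.2 ⟨hkK, hjK⟩, by
            show k + 2 ≤ j
            omega⟩) ⟨hkA, pos_iff_ne_zero.2 hne⟩
  · push Not at h
    refine ⟨0, 0, le_rfl, le_rfl, zero_le_one, by linarith, ?_⟩
    refine measure_mono_null (t := ⋃ j ∈ Finset.Icc 1 (gapK γ),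
      A ∩ gammaSegment γ (gapK γ) f j) ?_ ?_
    · rintro x ⟨hxA, -⟩
      obtain ⟨j, hj, hxj⟩ := exists_mem_gammaSegment hγ (hf x)
      exact Set.mem_biUnion hj ⟨hxA, hxj⟩
    · exact (measure_biUnion_null_iff (Finset.countable_toSet _)).2 fun j hj =>
        le_antisymm (h j hj) zero_le

end Segments

section Bracketing

variable {Ω X ι : Type*} [MeasurableSpace Ω] [MeasurableSpace X]

/-- The part of the space covered by the fibres of `φ` that are split by `f` across some pair of
non-adjacent γ-segments. -/
def splitRegion (P : Measure X) (γ : ℝ) (φ : X → ι) (f : X → ℝ) : Set X :=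
  {x | ∃ p ∈ gapPairs γ, SplitBy P γ f p (φ ⁻¹' {φ x})}

variable [Fintype ι] [MeasurableSpace ι] [MeasurableSingletonClass ι]

theorem exists_bracket {P : Measure X} [IsProbabilityMeasure P] {γ : ℝ} (hγ : 0 < γ) {φ : X → ι}
    (hφ : Measurable φ) {f : X → ℝ} (hf : ∀ x, f x ∈ Set.Icc (0 : ℝ) 1)
    (hreg : P.real (splitRegion P γ φ f) ≤ 3 * γ) :
    ∃ l u : ι → ℝ, (∀ i, 0 ≤ l i ∧ l i ≤ 1) ∧ (∀ i, 0 ≤ u i ∧ u i ≤ 1) ∧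
      (∀ᵐ x ∂P, f x ∈ Set.Icc (l (φ x)) (u (φ x))) ∧
      ∑ i, P.real (φ ⁻¹' {i}) * (u i - l i) ≤ 5 * γ := by
  classical
  have key (i : ι) : ∃ l u : ℝ, 0 ≤ l ∧ l ≤ u ∧ u ≤ 1 ∧
      u - l ≤ 2 * γ + (if ∃ p ∈ gapPairs γ, SplitBy P γ f p (φ ⁻¹' {i}) then 1 else 0) ∧
      P (φ ⁻¹' {i} ∩ {x | f x ∉ Set.Icc l u}) = 0 := by
    split_ifs with h
    · refine ⟨0, 1, le_rfl, zero_le_one, le_rfl, by linarith, ?_⟩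
      convert measure_empty (μ := P)
      ext x
      simpa using fun _ => hf x
    · push Not at h
      simpa using exists_bracket_of_not_splitBy hγ hf h
  choose l u h0l hlu hu1 hul hnull using key
  refine ⟨l, u, fun i => ⟨h0l i, (hlu i).trans (hu1 i)⟩, fun i => ⟨(h0l i).trans (hlu i), hu1 i⟩,
    ?_, ?_⟩
  · have : ∀ᵐ x ∂P, ∀ i, x ∉ φ ⁻¹' {i} ∩ {x | f x ∉ Set.Icc (l i) (u i)} :=
      ae_all_iff.2 fun i => measure_eq_zero_iff_ae_notMem.1 (hnull i)
    filter_upwards [this] with x hx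
    by_contra h
    exact hx (φ x) ⟨rfl, h⟩
  · set s : Finset ι := Finset.univ.filter fun i => ∃ p ∈ gapPairs γ, SplitBy P γ f p (φ ⁻¹' {i})
      with hs
    have hsum (t : Finset ι) : ∑ i ∈ t, P.real (φ ⁻¹' {i}) = P.real (φ ⁻¹' t) :=
      sum_measureReal_preimage_singleton t fun i _ => hφ (measurableSet_singleton i)
    calc ∑ i, P.real (φ ⁻¹' {i}) * (u i - l i)
        ≤ ∑ i, P.real (φ ⁻¹' {i}) * (2 * γ +
            (if ∃ p ∈ gapPairs γ, SplitBy P γ f p (φ ⁻¹' {i}) then 1 else 0)) :=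
          Finset.sum_le_sum fun i _ => mul_le_mul_of_nonneg_left (hul i) measureReal_nonneg
      _ = 2 * γ * ∑ i, P.real (φ ⁻¹' {i}) + ∑ i ∈ s, P.real (φ ⁻¹' {i}) := by
          simp only [mul_add, Finset.sum_add_distrib, mul_ite, mul_one, mul_zero, hs,
            Finset.sum_filter, Finset.mul_sum]
          congr 1
          exact Finset.sum_congr rfl fun i _ => by ring
      _ = 2 * γ + P.real (splitRegion P γ φ f) := by
          have hset : φ ⁻¹' s = splitRegion P γ φ f := by
            ext x
            simp [splitRegion, hs]
          rw [hsum, hsum, hset]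
          simp
      _ ≤ 5 * γ := by linarith

theorem inv_mul_sum_Icc_eq_birkhoffAverage {Ω : Type*} (T : Ω → Ω) (h : Ω → ℝ) (m : ℕ) (ω : Ω) :
    1 / (m : ℝ) * ∑ i ∈ Finset.Icc 1 m, h (T^[i] ω) = birkhoffAverage ℝ T h m (T ω) := by
  rw [birkhoffAverage, birkhoffSum, smul_eq_mul, one_div, Finset.range_eq_Ico]
  congr 1
  rw [← Finset.Ico_add_one_right_eq_Icc, ← Finset.sum_Ico_add' _ 0 m 1]
  rfl

theorem birkhoffAverage_comp_eq_sum {Ω X ι : Type*} [Fintype ι] (T : Ω → Ω) (ξ : Ω → X)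
    (φ : X → ι) (v : ι → ℝ) (m : ℕ) (ω : Ω) :
    birkhoffAverage ℝ T (fun ω => v (φ (ξ ω))) m ω =
      ∑ i, birkhoffAverage ℝ T (((fun ω => φ (ξ ω)) ⁻¹' {i}).indicator 1) m ω * v i := by
  classical
  simp only [birkhoffAverage, birkhoffSum, smul_eq_mul, mul_assoc, Finset.sum_mul]
  rw [← Finset.mul_sum, Finset.sum_comm]
  congr 1
  refine Finset.sum_congr rfl fun k _ => ?_
  simp [Set.indicator_apply]

theorem integral_comp_eq_sum {P : Measure X} [IsProbabilityMeasure P] {φ : X → ι}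
    (hφ : Measurable φ) (v : ι → ℝ) :
    ∫ x, v (φ x) ∂P = ∑ i, P.real (φ ⁻¹' {i}) * v i := by
  rw [← integral_map (f := v) hφ.aemeasurable (measurable_of_finite v).aestronglyMeasurable,
    integral_fintype (Integrable.of_finite)]
  exact Finset.sum_congr rfl fun i _ => by
    rw [smul_eq_mul, map_measureReal_apply hφ (measurableSet_singleton i)]

theorem birkhoffAverage_mono {Ω : Type*} {T : Ω → Ω} {g h : Ω → ℝ} {ω : Ω}
    (hgh : ∀ k, g (T^[k] ω) ≤ h (T^[k] ω)) (m : ℕ) :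
    birkhoffAverage ℝ T g m ω ≤ birkhoffAverage ℝ T h m ω := by
  simp only [birkhoffAverage, birkhoffSum, smul_eq_mul]
  exact mul_le_mul_of_nonneg_left (Finset.sum_le_sum fun k _ => hgh k) (by positivity)

theorem abs_sub_le_of_bracket {ι : Type*} [Fintype ι] {q p l u : ι → ℝ} {a b c : ℝ}
    (hl : ∀ i, 0 ≤ l i ∧ l i ≤ 1) (hu : ∀ i, 0 ≤ u i ∧ u i ≤ 1) (hpc : ∑ i, p i * (u i - l i) ≤ c)
    (hla : ∑ i, q i * l i ≤ a) (hau : a ≤ ∑ i, q i * u i)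
    (hlb : ∑ i, p i * l i ≤ b) (hbu : b ≤ ∑ i, p i * u i) :
    |a - b| ≤ ∑ i, |q i - p i| + c := by
  have key {v : ι → ℝ} (hv : ∀ i, 0 ≤ v i ∧ v i ≤ 1) :
      |∑ i, q i * v i - ∑ i, p i * v i| ≤ ∑ i, |q i - p i| := by
    rw [← Finset.sum_sub_distrib]
    refine (Finset.abs_sum_le_sum_abs _ _).trans (Finset.sum_le_sum fun i _ => ?_)
    rw [← sub_mul, abs_mul, abs_of_nonneg (hv i).1]
    exact mul_le_of_le_one_right (abs_nonneg _) (hv i).2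
  have h1 := abs_le.1 (key hl)
  have h2 := abs_le.1 (key hu)
  simp only [mul_sub, Finset.sum_sub_distrib] at hpc
  rw [abs_le]
  constructor <;> linarith

/-- If every member of `F` is split on at most a `3γ`-fraction of a fixed finite partition, then
the discrepancy is asymptotically at most `5γ`. -/
theorem ae_limsup_discrepancy_le {μ : Measure Ω} [IsProbabilityMeasure μ] {T : Ω → Ω}
    (hT : Ergodic T μ) {ξ : Ω → X} (hξ : Measurable ξ) {F : Set (X → ℝ)} (hFc : F.Countable)
    (hFm : ∀ f ∈ F, Measurable f) (hFb : ∀ f ∈ F, ∀ x, f x ∈ Set.Icc (0 : ℝ) 1) {γ : ℝ}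
    (hγ : 0 < γ) {φ : X → ι} (hφ : Measurable φ)
    (hreg : ∀ f ∈ F, (μ.map ξ).real (splitRegion (μ.map ξ) γ φ f) ≤ 3 * γ) :
    ∀ᵐ ω ∂μ, limsup (fun m => discrepancy μ T ξ F m ω) atTop ≤ 5 * γ := by
  set P := μ.map ξ with hP
  have : IsProbabilityMeasure P := Measure.isProbabilityMeasure_map hξ.aemeasurable
  have : Countable F := hFc.to_subtype
  have hbr (f : F) := exists_bracket hγ hφ (hFb f f.2) (hreg f f.2)
  choose l u hl hu hlu hsum using hbr
  set p : ι → ℝ := fun i => P.real (φ ⁻¹' {i}) with hp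
  set S : ι → Set Ω := fun i => (fun ω => φ (ξ ω)) ⁻¹' {i} with hS
  have hSm (i : ι) : MeasurableSet (S i) := (hφ.comp hξ) (measurableSet_singleton i)
  have hSp (i : ι) : ∫ ω, (S i).indicator (1 : Ω → ℝ) ω ∂μ = p i := by
    rw [integral_indicator_one (hSm i), hp, hP]
    exact (map_measureReal_apply hξ (hφ (measurableSet_singleton i))).symm
  have hconv : ∀ᵐ ω ∂μ, ∀ i, Tendsto (fun m => birkhoffAverage ℝ T ((S i).indicator 1) m ω) atTop
      (𝓝 (p i)) := by
    refine ae_all_iff.2 fun i => ?_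
    rw [← hSp i]
    refine ae_tendsto_birkhoffAverage hT (measurable_one.indicator (hSm i)) (C := 1) fun ω => ?_
    by_cases h : ω ∈ S i <;> simp [h]
  have hmem : ∀ᵐ ω ∂μ, ∀ f : F, ∀ k, (f : X → ℝ) (ξ (T^[k] ω)) ∈
      Set.Icc (l f (φ (ξ (T^[k] ω)))) (u f (φ (ξ (T^[k] ω)))) :=
    ae_all_iff.2 fun f => ae_all_iff.2 fun k =>
      (hT.quasiMeasurePreserving.iterate k).ae (ae_of_ae_map hξ.aemeasurable (hlu f))
  filter_upwards [hT.quasiMeasurePreserving.ae hconv, hT.quasiMeasurePreserving.ae hmem]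
    with ω hω1 hω2
  have hle (m : ℕ) : discrepancy μ T ξ F m ω ≤
      ∑ i, |birkhoffAverage ℝ T ((S i).indicator 1) m (T ω) - p i| + 5 * γ := by
    refine Real.iSup_le (fun f => ?_) (by positivity)
    rw [inv_mul_sum_Icc_eq_birkhoffAverage T (fun ω => (f : X → ℝ) (ξ ω)),
      ← integral_map hξ.aemeasurable (hFm f f.2).aestronglyMeasurable]
    have hfi : Integrable (f : X → ℝ) P :=
      Integrable.of_bound (hFm f f.2).aestronglyMeasurable 1 (ae_of_all _ fun x =>
        abs_le.2 ⟨by linarith [(hFb f f.2 x).1], (hFb f f.2 x).2⟩)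
    have hvi (v : ι → ℝ) : Integrable (fun x => v (φ x)) P :=
      (Integrable.of_finite (μ := P.map φ) (f := v)).comp_measurable hφ
    refine abs_sub_le_of_bracket (hl f) (hu f) (hsum f) ?_ ?_ ?_ ?_
    · rw [← birkhoffAverage_comp_eq_sum]
      exact birkhoffAverage_mono (fun k => (hω2 f k).1) m
    · rw [← birkhoffAverage_comp_eq_sum]
      exact birkhoffAverage_mono (fun k => (hω2 f k).2) m
    · rw [← integral_comp_eq_sum hφ]
      exact integral_mono_ae (hvi _) hfi ((hlu f).mono fun x hx => hx.1)
    · rw [← integral_comp_eq_sum hφ]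
      exact integral_mono_ae hfi (hvi _) ((hlu f).mono fun x hx => hx.2)
  have hlim : Tendsto (fun m => ∑ i, |birkhoffAverage ℝ T ((S i).indicator 1) m (T ω) - p i|
      + 5 * γ) atTop (𝓝 (5 * γ)) := by
    have := (tendsto_finsetSum Finset.univ fun i _ => ((hω1 i).sub_const (p i)).abs).add_const
      (5 * γ)
    simpa using this
  rw [← hlim.limsup_eq]
  refine limsup_le_limsup (Eventually.of_forall hle) ?_ hlim.isBoundedUnder_le
  exact (isBoundedUnder_of ⟨0, fun m => Real.iSup_nonneg fun f => abs_nonneg _⟩ :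
    IsBoundedUnder (· ≥ ·) atTop fun m => discrepancy μ T ξ F m ω).isCoboundedUnder_le

end Bracketing

section Exhaustion

variable {X κ : Type*} [MeasurableSpace X] {P : Measure X}

theorem tendsto_measure_inter_iUnion [IsFiniteMeasure P] {U : Filter κ} {G : κ → Set X}
    {A : ℕ → Set X} (hA : ∀ n, MeasurableSet (A n))
    (h : ∀ n, Tendsto (fun s => P (G s ∩ A n)) U (𝓝 0)) :
    Tendsto (fun s => P (G s ∩ ⋃ n, A n)) U (𝓝 0) := by
  rw [ENNReal.tendsto_nhds_zero]
  intro δ hδ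
  have hδ2 : 0 < δ / 2 := ENNReal.half_pos hδ.ne'
  have htail : Tendsto (fun n => P ((⋃ k, A k) \ Set.accumulate A n)) atTop (𝓝 0) := by
    have := tendsto_measure_iInter_atTop (μ := P)
      (s := fun n => (⋃ k, A k) \ Set.accumulate A n)
      (fun n => ((MeasurableSet.iUnion hA).diff
        (MeasurableSet.biUnion (Set.to_countable _) fun k _ => hA k)).nullMeasurableSet)
      (fun m n hmn => Set.sdiff_subset_sdiff_right (Set.monotone_accumulate hmn))
      ⟨0, measure_ne_top _ _⟩
    rwa [← Set.sdiff_iUnion, Set.iUnion_accumulate, Set.sdiff_self, measure_empty] at this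
  obtain ⟨N, hN⟩ := ((ENNReal.tendsto_nhds_zero.1 htail) _ hδ2).exists
  have hsum : Tendsto (fun s => ∑ k ∈ Finset.range (N + 1), P (G s ∩ A k)) U (𝓝 0) := by
    simpa using tendsto_finsetSum (Finset.range (N + 1)) fun k _ => h k
  filter_upwards [(ENNReal.tendsto_nhds_zero.1 hsum) _ hδ2] with s hs
  calc P (G s ∩ ⋃ n, A n)
      ≤ P ((⋃ k ∈ Finset.range (N + 1), G s ∩ A k) ∪ ((⋃ k, A k) \ Set.accumulate A N)) := by
        refine measure_mono ?_
        rintro x ⟨hxG, hxA⟩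
        by_cases hx : x ∈ Set.accumulate A N
        · obtain ⟨k, hk, hxk⟩ := Set.mem_accumulate.1 hx
          exact Or.inl (Set.mem_biUnion (Finset.mem_range.2 (Nat.lt_succ_of_le hk)) ⟨hxG, hxk⟩)
        · exact Or.inr ⟨hxA, hx⟩
    _ ≤ δ / 2 + δ / 2 := (measure_union_le _ _).trans
        (add_le_add ((measure_biUnion_finset_le _ _).trans hs) hN)
    _ = δ := ENNReal.add_halves δ

/-- The region on which a family of sets does not become negligible along a filter. -/
theorem exists_persistent_set [IsFiniteMeasure P] {U : Filter κ} {G : κ → Set X}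
    (h : ¬ Tendsto (fun s => P (G s)) U (𝓝 0)) :
    ∃ H, MeasurableSet H ∧ 0 < P H ∧ ∀ A ⊆ H, MeasurableSet A → 0 < P A →
      ¬ Tendsto (fun s => P (G s ∩ A)) U (𝓝 0) := by
  set N : Set (Set X) := {A | MeasurableSet A ∧ Tendsto (fun s => P (G s ∩ A)) U (𝓝 0)} with hN
  have hne : (P '' N).Nonempty :=
    ⟨_, ∅, ⟨MeasurableSet.empty, by simpa using tendsto_const_nhds⟩, rfl⟩
  obtain ⟨v, -, hv, hvN⟩ := exists_seq_tendsto_sSup hne (OrderTop.bddAbove _)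
  choose A hAN hAv using hvN
  set B := ⋃ n, A n with hB
  have hBN : B ∈ N := ⟨MeasurableSet.iUnion fun n => (hAN n).1,
    tendsto_measure_inter_iUnion (fun n => (hAN n).1) fun n => (hAN n).2⟩
  have hmax (C : Set X) (hC : C ∈ N) : P C ≤ P B :=
    (le_sSup (Set.mem_image_of_mem _ hC)).trans (le_of_tendsto' hv fun n => by
      rw [← hAv n]
      exact measure_mono (Set.subset_iUnion A n))
  have hunion {C : Set X} (hC : Tendsto (fun s => P (G s ∩ C)) U (𝓝 0)) :
      Tendsto (fun s => P (G s ∩ (B ∪ C))) U (𝓝 0) := by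
    refine tendsto_of_tendsto_of_tendsto_of_le_of_le tendsto_const_nhds
      (by simpa using hBN.2.add hC) (fun _ => zero_le) fun s => ?_
    simp only [Set.inter_union_distrib_left]
    exact measure_union_le _ _
  refine ⟨Bᶜ, hBN.1.compl, pos_iff_ne_zero.2 fun h0 => h ?_, fun A hAB hA hA0 hlim => ?_⟩
  · have := hunion (C := Bᶜ) (tendsto_const_nhds.congr fun s =>
      (measure_mono_null Set.inter_subset_right h0).symm)
    simpa using this
  · have := hmax _ ⟨hBN.1.union hA, hunion hlim⟩
    rw [measure_union (Set.disjoint_left.2 fun x hx hxA => hAB hxA hx) hA] at this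
    exact (ENNReal.lt_add_right (measure_ne_top P B) hA0.ne').not_ge this

end Exhaustion

section Shattering

variable {X : Type*} [MeasurableSpace X] {P : Measure X}

/-- Simultaneous splitting of finite collections of subsets of `H` can be iterated. -/
theorem exists_shattered {H : Set X} {F : Set (X → ℝ)} (hFm : ∀ f ∈ F, Measurable f) {γ : ℝ}
    {p : ℕ × ℕ}
    (hsplit : ∀ 𝒜 : Finset (Set X), (∀ A ∈ 𝒜, A ⊆ H ∧ MeasurableSet A ∧ 0 < P A) →
      ∃ f ∈ F, ∀ A ∈ 𝒜, SplitBy P γ f p A) (L : ℕ) (𝒜 : Finset (Set X))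
    (h𝒜 : ∀ A ∈ 𝒜, A ⊆ H ∧ MeasurableSet A ∧ 0 < P A) :
    ∃ f : ℕ → X → ℝ, (∀ ℓ, 1 ≤ ℓ → ℓ ≤ L → f ℓ ∈ F) ∧
      ∀ A ∈ 𝒜, ∀ ε : ℕ → ℕ, (∀ ℓ, 1 ≤ ℓ → ℓ ≤ L → ε ℓ = p.1 ∨ ε ℓ = p.2) →
        0 < P (A ∩ ⋂ ℓ ∈ Finset.Icc 1 L, gammaSegment γ (gapK γ) (f ℓ) (ε ℓ)) := by
  classical
  induction L generalizing 𝒜 with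
  | zero =>
    refine ⟨fun _ _ => 0, fun ℓ h1 h2 => by omega, fun A hA ε _ => ?_⟩
    simpa using (h𝒜 A hA).2.2
  | succ L ih =>
    obtain ⟨g, hgF, hg⟩ := hsplit 𝒜 h𝒜
    have hmeas := measurableSet_gammaSegment γ (gapK γ) (hFm g hgF)
    obtain ⟨f, hfF, hf⟩ := ih (𝒜.image (· ∩ gammaSegment γ (gapK γ) g p.1) ∪
        𝒜.image (· ∩ gammaSegment γ (gapK γ) g p.2)) (by
      intro A hA
      simp only [Finset.mem_union, Finset.mem_image] at hA
      rcases hA with ⟨B, hB, rfl⟩ | ⟨B, hB, rfl⟩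
      · exact ⟨Set.inter_subset_left.trans (h𝒜 B hB).1, (h𝒜 B hB).2.1.inter (hmeas _),
          (hg B hB).1⟩
      · exact ⟨Set.inter_subset_left.trans (h𝒜 B hB).1, (h𝒜 B hB).2.1.inter (hmeas _),
          (hg B hB).2⟩)
    refine ⟨Function.update f (L + 1) g, fun ℓ h1 h2 => ?_, fun A hA ε hε => ?_⟩
    · rcases eq_or_ne ℓ (L + 1) with rfl | hne
      · simpa using hgF
      · rw [Function.update_of_ne hne]
        exact hfF ℓ h1 (by omega)
    · refine (hf (A ∩ gammaSegment γ (gapK γ) g (ε (L + 1))) ?_ ε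
        fun ℓ h1 h2 => hε ℓ h1 (by omega)).trans_le (measure_mono ?_)
      · rcases hε (L + 1) (by omega) le_rfl with h | h <;> rw [h]
        · exact Finset.mem_union_left _ (Finset.mem_image_of_mem _ hA)
        · exact Finset.mem_union_right _ (Finset.mem_image_of_mem _ hA)
      · rintro x ⟨⟨hxA, hxg⟩, hx⟩
        refine ⟨hxA, Set.mem_iInter₂.2 fun ℓ hℓ => ?_⟩
        rcases eq_or_ne ℓ (L + 1) with rfl | hne
        · simpa using hxg
        · rw [Function.update_of_ne hne]
          refine Set.mem_iInter₂.1 hx ℓ (Finset.mem_Icc.2 ?_)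
          have := Finset.mem_Icc.1 hℓ
          omega

/-- The map recording which members of `s` a point belongs to; its fibres are the atoms of the
algebra generated by `s`. -/
def atomMap (s : Finset {A : Set X // MeasurableSet A}) (x : X) : s → Prop :=
  fun A => x ∈ A.1.1

theorem measurable_atomMap (s : Finset {A : Set X // MeasurableSet A}) :
    Measurable (atomMap s) :=
  measurable_pi_lambda _ fun A => measurableSet_setOfPred.1 A.1.2

theorem atomMap_preimage_subset {s : Finset {A : Set X // MeasurableSet A}}
    {A : {A : Set X // MeasurableSet A}} (hA : A ∈ s) {x : X} (hx : x ∈ A.1) :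
    atomMap s ⁻¹' {atomMap s x} ⊆ A.1 := fun y hy =>
  (congrFun (show atomMap s y = atomMap s x from hy) ⟨A, hA⟩).mpr hx

theorem SplitBy.mono {γ : ℝ} {f : X → ℝ} {p : ℕ × ℕ} {A B : Set X} (h : SplitBy P γ f p A)
    (hAB : A ⊆ B) : SplitBy P γ f p B :=
  ⟨h.1.trans_le (measure_mono (Set.inter_subset_inter_left _ hAB)),
    h.2.trans_le (measure_mono (Set.inter_subset_inter_left _ hAB))⟩

theorem exists_splitting_region [IsFiniteMeasure P] {F : Set (X → ℝ)} {γ c : ℝ} (hc : 0 < c)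
    (hF : ∀ s : Finset {A : Set X // MeasurableSet A}, ∃ f ∈ F,
      c < P.real (splitRegion P γ (atomMap s) f)) :
    ∃ p ∈ gapPairs γ, ∃ H, MeasurableSet H ∧ 0 < P H ∧ ∀ 𝒜 : Finset (Set X),
      (∀ A ∈ 𝒜, A ⊆ H ∧ MeasurableSet A ∧ 0 < P A) → ∃ f ∈ F, ∀ A ∈ 𝒜, SplitBy P γ f p A := by
  classical
  choose f hfF hfc using hF
  set U : Ultrafilter (Finset {A : Set X // MeasurableSet A}) := Ultrafilter.of atTop with hU
  have hUle : (U : Filter (Finset {A : Set X // MeasurableSet A})) ≤ atTop := Ultrafilter.of_le _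
  set G : ℕ × ℕ → Finset {A : Set X // MeasurableSet A} → Set X := fun p s =>
    {x | SplitBy P γ (f s) p (atomMap s ⁻¹' {atomMap s x})} with hG
  obtain ⟨p, hp, hpG⟩ : ∃ p ∈ gapPairs γ, ¬ Tendsto (fun s => P (G p s)) U (𝓝 0) := by
    by_contra! hall
    have hsum : Tendsto (fun s => ∑ p ∈ gapPairs γ, P (G p s)) U (𝓝 0) := by
      simpa using tendsto_finsetSum _ hall
    obtain ⟨s, hs⟩ := (hsum.eventually_lt_const (ENNReal.ofReal_pos.2 hc)).exists
    refine (hfc s).not_ge ?_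
    rw [measureReal_def]
    refine ENNReal.toReal_le_of_le_ofReal hc.le (le_trans ?_ hs.le)
    refine le_trans (measure_mono ?_) (measure_biUnion_finset_le _ _)
    rintro x ⟨q, hq, hx⟩
    exact Set.mem_biUnion hq hx
  obtain ⟨H, hHm, hH0, hH⟩ := exists_persistent_set hpG
  refine ⟨p, hp, H, hHm, hH0, fun 𝒜 h𝒜 => ?_⟩
  have hev : ∀ᶠ s in (U : Filter _), ∀ A ∈ 𝒜, SplitBy P γ (f s) p A := by
    refine (Finset.eventually_all 𝒜).2 fun A hA => ?_
    obtain ⟨hAH, hAm, hA0⟩ := h𝒜 A hA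
    have hne : ∀ᶠ s in (U : Filter _), P (G p s ∩ A) ≠ 0 := by
      rw [Ultrafilter.eventually_not]
      exact fun h0 => hH A hAH hAm hA0 (tendsto_const_nhds.congr' (h0.mono fun s hs => hs.symm))
    filter_upwards [hne, hUle (eventually_ge_atTop {⟨A, hAm⟩})] with s hs hAs
    obtain ⟨x, hxG, hxA⟩ := nonempty_of_measure_ne_zero hs
    exact SplitBy.mono hxG (atomMap_preimage_subset (A := ⟨A, hAm⟩) (by simpa using hAs) hxA)
  obtain ⟨s, hs⟩ := hev.exists
  exact ⟨f s, hfF s, hs⟩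

end Shattering

end MaximalJoin

open MaximalJoin

theorem exists_maximal_join
    {Ω : Type*} [MeasurableSpace Ω] (μ : Measure Ω) [IsProbabilityMeasure μ]
    (T : Ω → Ω) (ξ : Ω → unitInterval) (hT : Ergodic T μ) (hξ : Measurable ξ)
    (hmarg : μ.map ξ = (volume : Measure unitInterval))
    (F : Set (unitInterval → ℝ)) (hFc : F.Countable)
    (hFm : ∀ f ∈ F, Measurable f)
    (hFb : ∀ f ∈ F, ∀ x, f x ∈ Set.Icc (0 : ℝ) 1)
    (hreg : ∀ f ∈ F, ∀ a b : ℚ, 0 ≤ a → a < b → (b : ℝ) < 2 →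
      FinUnionIntervals (f ⁻¹' Set.Ico (a : ℝ) (b : ℝ)))
    (η : ℝ) (hη : 0 < η)
    (hΓ : ∀ᵐ ω ∂μ, η < Filter.limsup (fun m : ℕ => discrepancy μ T ξ F m ω) Filter.atTop)
    (L : ℕ) (hL : 1 ≤ L) :
    ∃ f : ℕ → unitInterval → ℝ,
      (∀ ℓ : ℕ, 1 ≤ ℓ → ℓ ≤ L → f ℓ ∈ F) ∧
      ∃ k k' : ℕ, 1 ≤ k ∧ k ≤ gapK (η / 5) ∧ 1 ≤ k' ∧ k' ≤ gapK (η / 5) ∧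
        2 ≤ |(k : ℤ) - (k' : ℤ)| ∧
        ∀ ε : ℕ → ℕ, (∀ ℓ : ℕ, 1 ≤ ℓ → ℓ ≤ L → ε ℓ = k ∨ ε ℓ = k') →
          0 < volume (⋂ ℓ ∈ Finset.Icc 1 L, gammaSegment (η / 5) (gapK (η / 5)) (f ℓ) (ε ℓ)) := by
  set γ := η / 5 with hγη
  have hγ : 0 < γ := by positivity
  have : IsProbabilityMeasure (μ.map ξ) := Measure.isProbabilityMeasure_map hξ.aemeasurable
  have hsplit (s : Finset {A : Set unitInterval // MeasurableSet A}) : ∃ f ∈ F,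
      3 * γ < (μ.map ξ).real (splitRegion (μ.map ξ) γ (atomMap s) f) := by
    classical
    by_contra! hle
    obtain ⟨ω, h1, h2⟩ := (hΓ.and (ae_limsup_discrepancy_le hT hξ hFc hFm hFb hγ
      (measurable_atomMap s) hle)).exists
    linarith
  obtain ⟨p, hp, H, hHm, hH0, hH⟩ := exists_splitting_region (by positivity) hsplit
  obtain ⟨f, hfF, hf⟩ := exists_shattered hFm hH L {H} (by simp [hHm, hH0])
  obtain ⟨hpK, hgap⟩ := Finset.mem_filter.1 hp
  obtain ⟨hp1, hp2⟩ := Finset.mem_product.1 hpK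
  rw [Finset.mem_Icc] at hp1 hp2
  refine ⟨f, hfF, p.1, p.2, hp1.1, hp1.2, hp2.1, hp2.2, ?_, fun ε hε => ?_⟩
  · rw [abs_sub_comm]
    exact le_trans (by omega) (le_abs_self _)
  · rw [← hmarg]
    exact (hf H (Finset.mem_singleton_self H) ε hε).trans_le (measure_mono Set.inter_subset_right)
end

section
/- Let 𝒞 = {C₁, C₂, …} be a countable collection of Borel subsets of [0,1] such that the maximum diameter of the cells of the join Jₙ = ⋁_{i=1}^n {Cᵢ, Cᵢᶜ} tends to zero as n → ∞. Then there exist a Borel-measurable map φ : [0,1] → [0,1] and a Borel set V₁ ⊆ [0,1] of Lebesgue measure one such that: (i) φ preserves Lebesgue measure and is injective on V₁; (ii) the image V₂ = φ(V₁) is a Borel set and the inverse map φ⁻¹ : V₂ → V₁ is Borel measurable; (iii) φ⁻¹ preserves Lebesgue measure; and (iv) for every C ∈ 𝒞 there exists a set U(C) ⊆ [0,1] equal to a finite union of intervals such that λ(φ(C) △ U(C)) = 0, where △ denotes symmetric difference and λ is Lebesgue measure. -/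
open MeasureTheory unitInterval

open Set Filter Topology ProbabilityTheory Cardinal

theorem FinUnionIntervals.image {X Y : Type*} [ConditionallyCompleteLinearOrder X]
    [DenselyOrdered X] [TopologicalSpace X] [OrderTopology X] [LinearOrder Y] [TopologicalSpace Y]
    [OrderClosedTopology Y] {s : Set X} (hs : FinUnionIntervals s) {f : X → Y}
    (hf : Continuous f) : FinUnionIntervals (f '' s) := by
  classical
  obtain ⟨S, hS, rfl⟩ := hs
  refine ⟨S.image (f '' ·), ?_, ?_⟩
  · intro J hJ
    obtain ⟨K, hK, rfl⟩ := Finset.mem_image.1 hJ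
    have := hS K hK
    exact (this.isPreconnected.image f hf.continuousOn).ordConnected
  · rw [sUnion_eq_biUnion, image_iUnion₂, sUnion_eq_biUnion]
    simp

theorem continuous_cantorFunction {c : ℝ} (h₀ : 0 ≤ c) (h₁ : c < 1) :
    Continuous (cantorFunction c) := by
  refine continuous_tsum (u := fun n => c ^ n) (fun n => ?_)
    (summable_geometric_of_lt_one h₀ h₁) (fun n f => ?_)
  · exact (continuous_of_discreteTopology (f := fun b : Bool => cond b (c ^ n) 0)).comp
      (continuous_apply n)
  · cases h : f n <;> simp [h, abs_of_nonneg, h₀]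

/-- Sequences between two sequences with a common prefix, in the order induced by the Cantor
function, have the same prefix. -/
theorem eq_of_cantorFunction_mem_Icc {c : ℝ} (h₀ : 0 < c) (h₁ : c < 1 / 2) {n : ℕ}
    {a b f : ℕ → Bool} (hab : ∀ k < n, a k = b k)
    (hf : cantorFunction c f ∈ Icc (cantorFunction c a) (cantorFunction c b)) :
    ∀ k < n, f k = a k := by
  intro k
  induction k using Nat.strong_induction_on with
  | _ k ih =>
    intro hk
    have hfa : ∀ j < k, f j = a j := fun j hj => ih j hj (hj.trans hk)
    cases hfk : f k <;> cases hak : a k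
    · rfl
    · exact absurd hf.1 (increasing_cantorFunction h₀ h₁ hfa hfk hak).not_ge
    · refine absurd hf.2 (increasing_cantorFunction h₀ h₁ (fun j hj => ?_)
        ((hab k hk).symm.trans hak) hfk).not_ge
      rw [hfa j hj, hab j (hj.trans hk)]
    · rfl

theorem exists_finUnionIntervals_cantorFunction_mem_iff {c : ℝ} (h₀ : 0 < c) (h₁ : c < 1 / 2)
    (n : ℕ) : ∃ T : Set ℝ, FinUnionIntervals T ∧
      ∀ f : ℕ → Bool, cantorFunction c f ∈ T ↔ f n = true := by
  classical
  let J (w : Fin (n + 1) → Bool) : Set ℝ :=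
    {t | ∃ a b : ℕ → Bool, (∀ k : Fin (n + 1), a k = w k) ∧ (∀ k : Fin (n + 1), b k = w k) ∧
      t ∈ Icc (cantorFunction c a) (cantorFunction c b)}
  refine ⟨⋃₀ ↑((Finset.univ.filter fun w => w (Fin.last n) = true).image J),
    ⟨_, ?_, rfl⟩, fun f => ?_⟩
  · intro K hK
    obtain ⟨w, -, rfl⟩ := Finset.mem_image.1 hK
    refine ⟨?_⟩
    rintro s ⟨a, _, ha, _, hs⟩ t ⟨_, b, _, hb, ht⟩ u hu
    exact ⟨a, b, ha, hb, hs.1.trans hu.1, hu.2.trans ht.2⟩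
  · simp only [Finset.coe_image, sUnion_image, mem_iUnion, Finset.coe_filter, Finset.mem_univ,
      true_and, mem_ofPred_eq, exists_prop]
    constructor
    · rintro ⟨w, hw, a, b, ha, hb, hf⟩
      have hab : ∀ k < n + 1, a k = b k := fun k hk => (ha ⟨k, hk⟩).trans (hb ⟨k, hk⟩).symm
      rw [eq_of_cantorFunction_mem_Icc h₀ h₁ hab hf n n.lt_succ_self]
      exact (ha (Fin.last n)).trans hw
    · intro h
      exact ⟨fun k => f k, h, f, f, fun _ => rfl, fun _ => rfl, le_rfl, le_rfl⟩

theorem continuous_cdf (μ : Measure ℝ) [IsProbabilityMeasure μ] [NullSingletonClass μ] :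
    Continuous (cdf μ) := by
  refine continuous_iff_continuousAt.2 fun x => ?_
  rw [(monotone_cdf μ).continuousAt_iff_leftLim_eq_rightLim, StieltjesFunction.rightLim_eq]
  refine le_antisymm ((monotone_cdf μ).leftLim_le le_rfl) ?_
  have h := (cdf μ).measure_singleton x
  rw [measure_cdf, measure_singleton, eq_comm, ENNReal.ofReal_eq_zero] at h
  linarith

/-- The cumulative distribution function, as a map to the unit interval. -/
noncomputable def unitCDF (μ : Measure ℝ) (t : ℝ) : I := ⟨cdf μ t, cdf_nonneg μ t, cdf_le_one μ t⟩

theorem monotone_unitCDF (μ : Measure ℝ) : Monotone (unitCDF μ) :=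
  fun _ _ h => monotone_cdf μ h

theorem continuous_unitCDF (μ : Measure ℝ) [IsProbabilityMeasure μ] [NullSingletonClass μ] :
    Continuous (unitCDF μ) :=
  (continuous_cdf μ).subtype_mk _

/-- The **probability integral transform**. -/
theorem measurePreserving_unitCDF (μ : Measure ℝ) [IsProbabilityMeasure μ]
    [NullSingletonClass μ] : MeasurePreserving (unitCDF μ) μ volume := by
  have hm : Measurable (unitCDF μ) := (continuous_unitCDF μ).measurable
  have : IsProbabilityMeasure (μ.map (unitCDF μ)) := Measure.isProbabilityMeasure_map hm.aemeasurable
  refine ⟨hm, Measure.ext_of_Iic _ _ fun a => ?_⟩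
  rw [Measure.map_apply hm measurableSet_Iic, unitInterval.volume_Iic]
  have key : ∀ b : ℝ, 0 < b → b < 1 →
      μ {t | cdf μ t < b} ≤ ENNReal.ofReal b ∧ ENNReal.ofReal b ≤ μ {t | cdf μ t ≤ b} := by
    intro b hb₀ hb₁
    obtain ⟨t₀, rfl⟩ : b ∈ range (cdf μ) := by
      refine mem_range_of_exists_le_of_exists_ge (continuous_cdf μ) ?_ ?_
      · exact (((tendsto_cdf_atBot μ).eventually_lt_const hb₀).mono fun _ h => h.le).exists
      · exact (((tendsto_cdf_atTop μ).eventually_const_lt hb₁).mono fun _ h => h.le).exists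
    rw [ofReal_cdf]
    exact ⟨measure_mono fun t ht => (monotone_cdf μ).reflect_lt ht |>.le,
      measure_mono fun t ht => monotone_cdf μ ht⟩
  change μ {t | cdf μ t ≤ a} = _
  refine le_antisymm ?_ ?_
  · rcases a.2.2.eq_or_lt with h | h
    · rw [h, ENNReal.ofReal_one]
      exact prob_le_one
    · have hlim : Tendsto (fun b : ℝ => ENNReal.ofReal b) (𝓝[>] (a : ℝ))
          (𝓝 (ENNReal.ofReal a)) := ENNReal.continuous_ofReal.continuousWithinAt
      refine ge_of_tendsto hlim ?_
      filter_upwards [Ioo_mem_nhdsGT h] with b hb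
      exact (measure_mono fun t (ht : cdf μ t ≤ a) => ht.trans_lt hb.1).trans
        (key b (a.2.1.trans_lt hb.1) hb.2).1
  · rcases a.2.1.eq_or_lt with h | h
    · simp [← h]
    rcases a.2.2.eq_or_lt with h' | h'
    · simp [h', cdf_le_one]
    · exact (key a h h').2

/-- A measure preserving self-map of a standard Borel space that is injective on a conull Borel set
has a measure preserving left inverse on that set. -/
theorem exists_measurePreserving_leftInverse {X : Type*} [MeasurableSpace X] [StandardBorelSpace X]
    {μ : Measure X} [Nonempty X] {φ : X → X} (hφ : MeasurePreserving φ μ μ) {V : Set X}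
    (hV : MeasurableSet V) (hVc : μ Vᶜ = 0) (hinj : InjOn φ V) :
    ∃ ψ : X → X, Measurable ψ ∧ (∀ x ∈ V, ψ (φ x) = x) ∧ MeasurePreserving ψ μ μ := by
  have := hV.standardBorel
  have hemb : MeasurableEmbedding (V.domRestrict φ) :=
    (hφ.measurable.comp measurable_subtype_coe).measurableEmbedding hinj.injective
  obtain ⟨ψ, hψ, hψφ⟩ := hemb.exists_measurable_extend measurable_subtype_coe
    (fun _ => ‹Nonempty X›)
  have hleft : ∀ x ∈ V, ψ (φ x) = x := fun x hx => congrFun hψφ ⟨x, hx⟩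
  refine ⟨ψ, hψ, hleft, hψ, ?_⟩
  have hae : ψ ∘ φ =ᵐ[μ] id := by
    filter_upwards [compl_mem_ae_iff.2 hVc] with x hx
    exact hleft x (not_not.1 hx)
  calc μ.map ψ = (μ.map φ).map ψ := by rw [hφ.map_eq]
    _ = μ.map (ψ ∘ φ) := Measure.map_map hψ hφ.measurable
    _ = μ := by rw [Measure.map_congr hae, Measure.map_id]

theorem eq_of_forall_mem_iff_of_diam_le {X : Type*} [MetricSpace X] [BoundedSpace X] {C : ℕ → Set X}
    (hdiam : ∀ ε : ℝ, 0 < ε → ∃ N : ℕ, ∀ n ≥ N, ∀ D : ℕ → Set X,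
      (∀ i < n, D i = C i ∨ D i = (C i)ᶜ) →
      Metric.diam (⋂ i ∈ Finset.range n, D i) ≤ ε) {x y : X} (h : ∀ i, x ∈ C i ↔ y ∈ C i) :
    x = y := by
  classical
  refine dist_le_zero.1 (le_of_forall_pos_le_add fun ε hε => ?_)
  obtain ⟨N, hN⟩ := hdiam ε hε
  rw [zero_add]
  refine le_trans ?_ (hN N le_rfl (fun i => if x ∈ C i then C i else (C i)ᶜ) fun i _ => by
    by_cases hx : x ∈ C i <;> simp [hx])
  refine Metric.dist_le_diam_of_mem (Bornology.IsBounded.all _) ?_ ?_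
  · refine mem_iInter₂.2 fun i _ => ?_
    by_cases hx : x ∈ C i <;> simp [hx]
  · refine mem_iInter₂.2 fun i _ => ?_
    by_cases hx : x ∈ C i <;> simp [hx, ← h i]

theorem exists_interval_isomorphism
    (C : ℕ → Set unitInterval) (hC : ∀ i, MeasurableSet (C i))
    (hdiam : ∀ ε : ℝ, 0 < ε → ∃ N : ℕ, ∀ n ≥ N, ∀ D : ℕ → Set unitInterval,
      (∀ i < n, D i = C i ∨ D i = (C i)ᶜ) →
      Metric.diam (⋂ i ∈ Finset.range n, D i) ≤ ε) :
    ∃ (φ : unitInterval → unitInterval) (V₁ : Set unitInterval),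
      Measurable φ ∧ MeasurableSet V₁ ∧ volume V₁ = 1 ∧
      MeasurePreserving φ (volume : Measure unitInterval) volume ∧
      Set.InjOn φ V₁ ∧
      MeasurableSet (φ '' V₁) ∧
      (∃ ψ : unitInterval → unitInterval, Measurable ψ ∧ (∀ x ∈ V₁, ψ (φ x) = x) ∧
        MeasurePreserving ψ (volume : Measure unitInterval) volume) ∧
      (∀ i : ℕ, ∃ U : Set unitInterval, FinUnionIntervals U ∧
        volume (symmDiff (φ '' C i) U) = 0) := by
  classical
  have h₀ : (0 : ℝ) < 1 / 3 := by norm_num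
  have h₁ : (1 / 3 : ℝ) < 1 / 2 := by norm_num
  let code : I → ℕ → Bool := fun x i => decide (x ∈ C i)
  let g : I → ℝ := fun x => cantorFunction (1 / 3) (code x)
  have hcode : Measurable code := measurable_pi_lambda _ fun i =>
    measurable_to_bool (by simpa [code, preimage] using hC i)
  have hg : Measurable g :=
    (continuous_cantorFunction h₀.le (h₁.trans (by norm_num))).measurable.comp hcode
  have hginj : Function.Injective g := fun x y hxy =>
    eq_of_forall_mem_iff_of_diam_le hdiam fun i => by
      simpa [code] using congrFun (cantorFunction_injective h₀ h₁ hxy) i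
  let μ : Measure ℝ := (volume : Measure I).map g
  have : IsProbabilityMeasure μ := Measure.isProbabilityMeasure_map hg.aemeasurable
  have : NullSingletonClass μ := ⟨fun t => by
    rw [Measure.map_apply hg (measurableSet_singleton t)]
    exact (subsingleton_singleton.preimage hginj).measure_zero _⟩
  have hφ : MeasurePreserving (unitCDF μ ∘ g) volume volume :=
    (measurePreserving_unitCDF μ).comp ⟨hg, rfl⟩
  let N : Set I := {c | ∃ x y, x < y ∧ unitCDF μ x = c ∧ unitCDF μ y = c}
  have hN : N.Countable := (monotone_unitCDF μ).countable_setOfPred_two_preimages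
  have hNinj : ∀ s t, unitCDF μ s ∉ N → unitCDF μ s = unitCDF μ t → s = t := by
    intro s t hs hst
    by_contra hne
    rcases lt_or_gt_of_ne hne with h | h
    · exact hs ⟨s, t, h, rfl, hst.symm⟩
    · exact hs ⟨t, s, h, hst.symm, rfl⟩
  let V : Set I := (unitCDF μ ∘ g) ⁻¹' Nᶜ
  have hV : MeasurableSet V := hφ.measurable hN.measurableSet.compl
  have hVc : volume Vᶜ = 0 := by
    rw [← preimage_compl, compl_compl, hφ.measure_preimage hN.measurableSet.nullMeasurableSet]
    exact hN.measure_zero _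
  have hinj : InjOn (unitCDF μ ∘ g) V := fun x hx y _ hxy => hginj (hNinj _ _ hx hxy)
  have himg : MeasurableSet ((unitCDF μ ∘ g) '' V) :=
    hV.image_of_measurable_injOn hφ.measurable hinj
  have himgc : volume ((unitCDF μ ∘ g) '' V)ᶜ = 0 := by
    rw [← hφ.measure_preimage himg.compl.nullMeasurableSet]
    exact measure_mono_null (compl_subset_compl.2 (subset_preimage_image _ _)) hVc
  refine ⟨unitCDF μ ∘ g, V, hφ.measurable, hV, (prob_compl_eq_zero_iff hV).1 hVc, hφ, hinj, himg,
    exists_measurePreserving_leftInverse hφ hV hVc hinj, fun i => ?_⟩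
  obtain ⟨T, hT, hTi⟩ := exists_finUnionIntervals_cantorFunction_mem_iff h₀ h₁ i
  have hgT : ∀ x, g x ∈ T ↔ x ∈ C i := fun x => (hTi _).trans decide_eq_true_iff
  refine ⟨unitCDF μ '' T, hT.image (continuous_unitCDF μ),
    measure_mono_null ?_ (measure_union_null (hN.measure_zero volume) himgc)⟩
  rintro y (⟨⟨x, hx, rfl⟩, hy⟩ | ⟨⟨t, ht, rfl⟩, hy⟩)
  · exact absurd ⟨g x, (hgT x).2 hx, rfl⟩ hy
  · by_contra hcon
    rw [mem_union, not_or, notMem_compl_iff] at hcon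
    obtain ⟨htN, x, -, hxt⟩ := hcon
    obtain rfl := hNinj _ _ htN hxt.symm
    exact hy ⟨x, (hgT x).1 ht, rfl⟩
end

section
/- Let P and Q be probability measures on a measurable space, let J be a finite measurable partition of the space, let 0 < δ ≤ 1 and η > 0, and suppose |Q(A) − P(A)| ≤ δ·P(A) for every A ∈ J. Let f be a measurable function with values in [0,1] such that |∫ f dQ − ∫ f dP| > η. Let H = {A ∈ J : |∫_A f dQ − ∫_A f dP| > (η/2)·P(A)} and let G be the union of the sets in H. Then P(G) ≥ η/6. -/
open MeasureTheory

theorem integral_eq_sum_setIntegral_of_partition {X : Type*} [MeasurableSpace X] {μ : Measure X}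
    {J : Finset (Set X)} (hJm : ∀ A ∈ J, MeasurableSet A)
    (hJd : (↑J : Set (Set X)).PairwiseDisjoint id)
    (hJu : ⋃₀ (↑J : Set (Set X)) = (Set.univ : Set X)) {f : X → ℝ} (hf : Integrable f μ) :
    ∫ x, f x ∂μ = ∑ A ∈ J, ∫ x in A, f x ∂μ := by
  have h := integral_biUnion_finset (μ := μ) (f := f) (s := id) J hJm hJd
    fun _ _ => hf.integrableOn
  rw [← setIntegral_univ, ← hJu, Set.sUnion_eq_biUnion]
  simpa using h

theorem integrable_of_mem_Icc {X : Type*} [MeasurableSpace X] {μ : Measure X}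
    [IsFiniteMeasure μ] {f : X → ℝ} (hf : Measurable f)
    (hfb : ∀ x, f x ∈ Set.Icc (0 : ℝ) 1) : Integrable f μ :=
  Integrable.of_mem_Icc 0 1 hf.aemeasurable (.of_forall hfb)

theorem setIntegral_mem_Icc_measureReal {X : Type*} [MeasurableSpace X] {μ : Measure X}
    [IsFiniteMeasure μ] {f : X → ℝ} (hf : Measurable f)
    (hfb : ∀ x, f x ∈ Set.Icc (0 : ℝ) 1) (A : Set X) :
    ∫ x in A, f x ∂μ ∈ Set.Icc 0 (μ.real A) := by
  refine ⟨integral_nonneg fun x => (hfb x).1, ?_⟩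
  have h : ∫ x in A, f x ∂μ ≤ ∫ _ in A, (1 : ℝ) ∂μ :=
    integral_mono (integrable_of_mem_Icc hf hfb) (integrable_const _) fun x => (hfb x).2
  simpa using h

theorem measure_of_large_discrepancy_cells
    {X : Type*} [MeasurableSpace X] (P Q : Measure X)
    [IsProbabilityMeasure P] [IsProbabilityMeasure Q]
    (J : Finset (Set X)) (hJm : ∀ A ∈ J, MeasurableSet A)
    (hJd : (↑J : Set (Set X)).PairwiseDisjoint id)
    (hJu : ⋃₀ (↑J : Set (Set X)) = (Set.univ : Set X))
    (δ η : ℝ) (hδ0 : 0 < δ) (hδ1 : δ ≤ 1) (hη : 0 < η)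
    (hQP : ∀ A ∈ J, |(Q A).toReal - (P A).toReal| ≤ δ * (P A).toReal)
    (f : X → ℝ) (hf : Measurable f) (hfb : ∀ x, f x ∈ Set.Icc (0 : ℝ) 1)
    (hdisc : η < |∫ x, f x ∂Q - ∫ x, f x ∂P|) :
    ENNReal.ofReal (η / 6) ≤
      P (⋃ A ∈ {A : Set X | A ∈ J ∧
        (η / 2) * (P A).toReal < |∫ x in A, f x ∂Q - ∫ x in A, f x ∂P|}, A) := by
  classical
  set d : Set X → ℝ := fun A => ∫ x in A, f x ∂Q - ∫ x in A, f x ∂P with hd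
  set H := J.filter fun A => (η / 2) * P.real A < |d A| with hH
  have hG : (⋃ A ∈ {A : Set X | A ∈ J ∧
      (η / 2) * (P A).toReal < |∫ x in A, f x ∂Q - ∫ x in A, f x ∂P|}, A) = ⋃ A ∈ H, A := by
    ext x
    simp [hH, hd, Measure.real]
  have hHJ : H ⊆ J := Finset.filter_subset _ _
  have hPG : P.real (⋃ A ∈ H, A) = ∑ A ∈ H, P.real A :=
    measureReal_biUnion_finset (hJd.subset (Finset.coe_subset.2 hHJ)) fun A hA => hJm A (hHJ hA)
  have hPJ : ∑ A ∈ J, P.real A = 1 := by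
    rw [← measureReal_biUnion_finset (f := fun A => A) hJd hJm]
    have : (⋃ A ∈ J, A) = (Set.univ : Set X) := by
      rw [← hJu, Set.sUnion_eq_biUnion]; rfl
    rw [this, probReal_univ]
  have hbound : ∀ A ∈ J, |d A| ≤ 2 * P.real A := fun A hA => by
    have hP := setIntegral_mem_Icc_measureReal (μ := P) hf hfb A
    have hQ := setIntegral_mem_Icc_measureReal (μ := Q) hf hfb A
    have hA' : Q.real A - P.real A ≤ δ * P.real A := (abs_le.1 (hQP A hA)).2
    have hA0 : 0 ≤ P.real A := measureReal_nonneg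
    have hδA : δ * P.real A ≤ 1 * P.real A := by gcongr
    rw [abs_le]
    constructor <;> linarith [hP.1, hP.2, hQ.1, hQ.2]
  have hcell : ∀ A ∈ J, |d A| ≤ η / 2 * P.real A +
      if (η / 2) * P.real A < |d A| then 2 * P.real A else 0 := fun A hA => by
    split_ifs with h
    · have : 0 ≤ η / 2 * P.real A := by positivity
      linarith [hbound A hA]
    · linarith
  have hsum : |∫ x, f x ∂Q - ∫ x, f x ∂P| ≤ η / 2 + 2 * P.real (⋃ A ∈ H, A) := by
    rw [integral_eq_sum_setIntegral_of_partition hJm hJd hJu (integrable_of_mem_Icc hf hfb),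
      integral_eq_sum_setIntegral_of_partition hJm hJd hJu (integrable_of_mem_Icc hf hfb),
      ← Finset.sum_sub_distrib]
    refine (Finset.abs_sum_le_sum_abs _ _).trans ((Finset.sum_le_sum hcell).trans_eq ?_)
    rw [Finset.sum_add_distrib, ← Finset.mul_sum, hPJ, ← Finset.sum_filter, ← Finset.mul_sum,
      hPG, mul_one]
  rw [hG, ENNReal.ofReal_le_iff_le_toReal (measure_ne_top _ _)]
  change η / 6 ≤ P.real _
  linarith
end

section
/- Let 0 < δ ≤ 1, α > 0, and set ε = δ / (2(δ + 1)). Let I = (x − α, x + α) be an open interval, let Q be a Borel subset of [0,1] with λ(I ∩ Q) ≥ (1 − ε)·2α, let 𝒟 be a partition of [0,1] into intervals each of length less than δα/4, and let H be a finite family of pairwise disjoint Borel subsets of [0,1] such that each A ∈ H is contained in some element of 𝒟 and each A ∈ H satisfies either A ⊆ Q or A ⊆ [0,1] ∖ Q. If λ(I ∩ G) > 2α(1 − ε)δ, where G is the union of the sets in H, then there exists A ∈ H with A ⊆ I, λ(A ∩ Q) > 0, and A ⊆ Q. -/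
open MeasureTheory

theorem exists_cell_inside_interval_and_Q
    (δ α x : ℝ) (hδ0 : 0 < δ) (hδ1 : δ ≤ 1) (hα : 0 < α)
    (Q : Set ℝ) (hQm : MeasurableSet Q) (hQsub : Q ⊆ Set.Icc 0 1)
    (hQI : ENNReal.ofReal ((1 - δ / (2 * (δ + 1))) * (2 * α)) ≤
      volume (Set.Ioo (x - α) (x + α) ∩ Q))
    (𝒟 : Set (Set ℝ)) (h𝒟d : 𝒟.PairwiseDisjoint id) (h𝒟u : ⋃₀ 𝒟 = Set.Icc 0 1)
    (h𝒟i : ∀ d ∈ 𝒟, d.OrdConnected ∧ Metric.diam d < δ * α / 4)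
    (H : Finset (Set ℝ)) (hHm : ∀ A ∈ H, MeasurableSet A)
    (hHd : (↑H : Set (Set ℝ)).PairwiseDisjoint id)
    (hHD : ∀ A ∈ H, ∃ d ∈ 𝒟, A ⊆ d)
    (hHQ : ∀ A ∈ H, A ⊆ Q ∨ A ⊆ Set.Icc 0 1 \ Q)
    (hG : ENNReal.ofReal (2 * α * (1 - δ / (2 * (δ + 1))) * δ) <
      volume (Set.Ioo (x - α) (x + α) ∩ ⋃₀ (↑H : Set (Set ℝ)))) :
    ∃ A ∈ H, A ⊆ Set.Ioo (x - α) (x + α) ∧ 0 < volume (A ∩ Q) ∧ A ⊆ Q := by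
  by_contra! hno
  set ε := δ / (2 * (δ + 1)) with hε
  set I := Set.Ioo (x - α) (x + α) with hI
  have hε_mul : ε * (δ + 1) = δ / 2 := by rw [hε]; field_simp
  have hε0 : 0 < ε := by positivity
  have hε1 : ε ≤ 1 := by nlinarith
  have hdiff : volume (I \ Q) ≤ ENNReal.ofReal (ε * (2 * α)) := by
    have hsum : volume (I ∩ Q) + volume (I \ Q) = ENNReal.ofReal (2 * α) := by
      rw [measure_inter_add_sdiff I hQm, hI, Real.volume_Ioo]
      congr 1
      ring
    have hfin : ENNReal.ofReal ((1 - ε) * (2 * α)) ≠ ⊤ := ENNReal.ofReal_ne_top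
    refine (ENNReal.add_le_add_iff_left hfin).1 ?_
    calc ENNReal.ofReal ((1 - ε) * (2 * α)) + volume (I \ Q)
        ≤ volume (I ∩ Q) + volume (I \ Q) := by gcongr
      _ = ENNReal.ofReal ((1 - ε) * (2 * α)) + ENNReal.ofReal (ε * (2 * α)) := by
        rw [hsum, ← ENNReal.ofReal_add (mul_nonneg (by linarith) (by linarith)) (by positivity)]
        congr 1
        ring
  let N : Set ℝ := ⋃ A ∈ {A | A ∈ H ∧ A ⊆ I ∧ A ⊆ Q}, A
  have hN : volume N = 0 := by
    refine (measure_biUnion_null_iff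
      (H.finite_toSet.subset fun A hA => hA.1).countable).2 fun A hA => ?_
    by_contra h
    refine hno A hA.1 hA.2.1 ?_ hA.2.2
    rw [Set.inter_eq_left.2 hA.2.2]
    exact pos_iff_ne_zero.2 h
  have hcover : I ∩ ⋃₀ (↑H : Set (Set ℝ)) ⊆ I \ Q ∪ (Set.Ioo (x - α) (x - α + δ * α / 4) ∪
      Set.Ioo (x + α - δ * α / 4) (x + α)) ∪ N := by
    rintro y ⟨hyI, A, hA, hyA⟩
    rcases hHQ A hA with hAQ | hAQ
    · by_cases hAI : A ⊆ I
      · exact Or.inr (Set.mem_biUnion (⟨hA, hAI, hAQ⟩ : A ∈ {A | A ∈ H ∧ A ⊆ I ∧ A ⊆ Q}) hyA)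
      · obtain ⟨z, hzA, hzI⟩ := Set.not_subset.1 hAI
        obtain ⟨d, hd, hAd⟩ := hHD A hA
        have hdb : Bornology.IsBounded d :=
          (Metric.isBounded_Icc (0 : ℝ) 1).subset (h𝒟u ▸ Set.subset_sUnion_of_mem hd)
        have hdist := (Metric.dist_le_diam_of_mem hdb (hAd hyA) (hAd hzA)).trans_lt (h𝒟i d hd).2
        rw [Real.dist_eq, abs_lt] at hdist
        rw [hI, Set.mem_Ioo, not_and_or, not_lt, not_lt] at hzI
        refine Or.inl (Or.inr ?_)
        rcases hzI with hz | hz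
        · exact Or.inl ⟨hyI.1, by linarith⟩
        · exact Or.inr ⟨by linarith, hyI.2⟩
    · exact Or.inl (Or.inl ⟨hyI, (hAQ hyA).2⟩)
  refine hG.not_ge ?_
  have hδα : 0 < δ * α := mul_pos hδ0 hα
  calc volume (I ∩ ⋃₀ (↑H : Set (Set ℝ)))
      ≤ volume (I \ Q) + (volume (Set.Ioo (x - α) (x - α + δ * α / 4)) +
          volume (Set.Ioo (x + α - δ * α / 4) (x + α))) + volume N :=
        (measure_mono hcover).trans <| (measure_union_le _ _).trans <|
          add_le_add_left ((measure_union_le _ _).trans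
            (add_le_add_right (measure_union_le _ _) _)) _
    _ ≤ ENNReal.ofReal (ε * (2 * α)) + (ENNReal.ofReal (δ * α / 4) +
          ENNReal.ofReal (δ * α / 4)) := by
        rw [hN, add_zero, Real.volume_Ioo, Real.volume_Ioo, add_sub_cancel_left, sub_sub_cancel]
        gcongr
    _ ≤ ENNReal.ofReal (2 * α * (1 - ε) * δ) := by
        rw [← ENNReal.ofReal_add (by positivity) (by positivity),
          ← ENNReal.ofReal_add (by positivity) (by positivity)]
        refine ENNReal.ofReal_le_ofReal ?_
        have h : 2 * α * (1 - ε) * δ - ε * (2 * α) = δ * α := by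
          linear_combination -2 * α * hε_mul
        linarith
end
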